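/- arXiv:2301.10131 — 6 statements merged into one kernel-verified Lean document; each statement's English description precedes it below -/
import Mathlib

section
/- For every δ > 0 there exists τ > 0 such that for every ν > 0 and every ε > 0 there exists n₀ ∈ ℕ such that the following holds for every even n ≥ n₀ and every integer d ≥ δn: if G is a d-regular robust (ν,τ)-expander on n vertices and N is a perfect matching of G, then, writing pm(H) for the number of perfect matchings of a graph H and G−N for the graph obtained from G by deleting the edges of N, one has (1−ε)·e^{−n/(2d)} ≤ pm(G−N)/pm(G) ≤ (1+ε)·e^{−n/(2d)} (in particular pm(G) > 0). -/
open Finset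

namespace RPM

/-- The `ν`-robust neighbourhood of a vertex set `S` in a graph `G` on `n` vertices:
all vertices having at least `ν * n` neighbours in `S`. -/
def RN {V : Type*} [Fintype V] (G : SimpleGraph V) (ν : ℝ) (S : Set V) : Set V :=
  {v : V | ν * (Fintype.card V : ℝ) ≤ (Nat.card {u : V | u ∈ S ∧ G.Adj v u} : ℝ)}

/-- `G` is a robust `(ν, τ)`-expander. -/
def RobustExpander {V : Type*} [Fintype V] (G : SimpleGraph V) (ν τ : ℝ) : Prop :=
  ∀ S : Set V,
    τ * (Fintype.card V : ℝ) ≤ (Nat.card S : ℝ) →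
    (Nat.card S : ℝ) ≤ (1 - τ) * (Fintype.card V : ℝ) →
    (Nat.card S : ℝ) + ν * (Fintype.card V : ℝ) ≤ (Nat.card (RN G ν S) : ℝ)

/-- `M` (a set of edges) is a perfect matching of `G`: its edges are edges of `G`,
and every vertex lies in exactly one edge of `M` (in particular the edges are
pairwise disjoint and cover all vertices). -/
def IsPM {V : Type*} (G : SimpleGraph V) (M : Finset (Sym2 V)) : Prop :=
  (∀ e ∈ M, e ∈ G.edgeSet) ∧ ∀ v : V, ∃! e, e ∈ M ∧ v ∈ e

/-- The number of perfect matchings of `G`. -/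
noncomputable def pmCount {V : Type*} (G : SimpleGraph V) : ℕ :=
  Nat.card {M : Finset (Sym2 V) // IsPM G M}

/-- `N` (a set of edges) is a matching in `G`: edges of `G`, pairwise disjoint. -/
def IsMatchingIn {V : Type*} (G : SimpleGraph V) (N : Finset (Sym2 V)) : Prop :=
  (∀ e ∈ N, e ∈ G.edgeSet) ∧ ∀ e ∈ N, ∀ f ∈ N, e ≠ f → ∀ v : V, v ∈ e → v ∉ f

/-- `G` is `d`-regular: every vertex has exactly `d` neighbours. -/
def RegularDeg {V : Type*} (G : SimpleGraph V) (d : ℕ) : Prop :=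
  ∀ v : V, Nat.card {u : V | G.Adj v u} = d

/-- Probability that a uniformly random perfect matching of `G` contains the edge `e`. -/
noncomputable def edgeProb {V : Type*} (G : SimpleGraph V) (e : Sym2 V) : ℝ :=
  (Nat.card {M : Finset (Sym2 V) // IsPM G M ∧ e ∈ M} : ℝ) / (pmCount G : ℝ)

/-- `P[X = k]` where `X = |M ∩ N|` for a uniformly random perfect matching `M` of `G`. -/
noncomputable def interProb {V : Type*} [DecidableEq V] (G : SimpleGraph V)
    (N : Finset (Sym2 V)) (k : ℕ) : ℝ :=
  (Nat.card {M : Finset (Sym2 V) // IsPM G M ∧ (M ∩ N).card = k} : ℝ) / (pmCount G : ℝ)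

/-- The Poisson probability mass function with parameter `lam`. -/
noncomputable def poissonPMF (lam : ℝ) (k : ℕ) : ℝ :=
  Real.exp (-lam) * lam ^ k / (Nat.factorial k)

/-- The transition matrix of the walk which moves from `x` to `σ w` for a uniformly chosen
neighbour `w` of `x` in the `d`-regular graph `G`. -/
noncomputable def walk {V : Type*} (G : SimpleGraph V) [DecidableRel G.Adj] (d : ℕ)
    (σ : Equiv.Perm V) : Matrix V V ℝ :=
  fun x z => if G.Adj x (σ⁻¹ z) then (d : ℝ)⁻¹ else 0

section Walk

variable {V : Type*} [Fintype V] [DecidableEq V] (G : SimpleGraph V) [DecidableRel G.Adj] {d : ℕ}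
  (σ : Equiv.Perm V)

omit [DecidableEq V] in
theorem walk_mul_apply (A : Matrix V V ℝ) (x y : V) :
    (walk G d σ * A) x y = (d : ℝ)⁻¹ * ∑ w ∈ G.neighborFinset x, A (σ w) y := by
  rw [Matrix.mul_apply, ← Equiv.sum_comp σ, Finset.mul_sum, SimpleGraph.neighborFinset_eq_filter,
    Finset.sum_filter]
  refine Finset.sum_congr rfl fun w _ => ?_
  simp [walk]

theorem walk_pow_succ_apply (k : ℕ) (x y : V) :
    (walk G d σ ^ (k + 1)) x y
      = (d : ℝ)⁻¹ * ∑ w ∈ G.neighborFinset x, (walk G d σ ^ k) (σ w) y := by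
  rw [pow_succ', walk_mul_apply]

variable {G}

theorem walk_mem_doublyStochastic (hd : 0 < d) (hreg : ∀ x, (G.neighborFinset x).card = d) :
    walk G d σ ∈ doublyStochastic ℝ V := by
  have hd' : (d : ℝ) ≠ 0 := by positivity
  have key : ∀ x, ∑ w, (if G.Adj x w then (d : ℝ)⁻¹ else 0) = 1 := by
    intro x
    rw [← Finset.sum_filter, ← SimpleGraph.neighborFinset_eq_filter, Finset.sum_const, hreg]
    simp [hd']
  rw [mem_doublyStochastic_iff_sum]
  refine ⟨fun x z => ?_, fun x => ?_, fun z => ?_⟩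
  · unfold walk; split_ifs <;> positivity
  · rw [← key x, ← Equiv.sum_comp σ]
    simp [walk]
  · rw [← key (σ⁻¹ z)]
    simp [walk, G.adj_comm]

theorem walk_pow_mem (hd : 0 < d) (hreg : ∀ x, (G.neighborFinset x).card = d) (k : ℕ) :
    walk G d σ ^ k ∈ doublyStochastic ℝ V :=
  pow_mem (walk_mem_doublyStochastic σ hd hreg) k

theorem walk_pow_nonneg (hd : 0 < d) (hreg : ∀ x, (G.neighborFinset x).card = d) (k : ℕ)
    (x y : V) : 0 ≤ (walk G d σ ^ k) x y :=
  (mem_doublyStochastic_iff_sum.1 (walk_pow_mem σ hd hreg k)).1 x y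

omit [Fintype V] [DecidableEq V] in
theorem walk_apply_le (x y : V) : walk G d σ x y ≤ (d : ℝ)⁻¹ := by
  unfold walk; split_ifs
  · exact le_rfl
  · positivity

theorem walk_pow_le (hd : 0 < d) (hreg : ∀ x, (G.neighborFinset x).card = d) {k : ℕ}
    (hk : 1 ≤ k) (x y : V) : (walk G d σ ^ k) x y ≤ (d : ℝ)⁻¹ := by
  have hd' : (d : ℝ) ≠ 0 := by positivity
  induction k, hk using Nat.le_induction generalizing x with
  | base => simpa using walk_apply_le σ x y
  | succ k _ ih =>
    rw [walk_pow_succ_apply]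
    have := Finset.sum_le_card_nsmul (G.neighborFinset x) (fun w => (walk G d σ ^ k) (σ w) y) _
      (fun w _ => ih (σ w))
    rw [hreg, nsmul_eq_mul] at this
    calc _ ≤ (d : ℝ)⁻¹ * (d * (d : ℝ)⁻¹) := by gcongr
      _ = _ := by rw [mul_inv_cancel₀ hd', mul_one]

/-- Multiplying by a doubly stochastic matrix whose entries are at least `c / n` contracts the
distance of a doubly stochastic matrix to the uniform matrix. -/
theorem doublyStochastic_contract {Q A : Matrix V V ℝ} (hQ : Q ∈ doublyStochastic ℝ V)
    (hA : A ∈ doublyStochastic ℝ V) {c D : ℝ}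
    (hc : ∀ x y, c / Fintype.card V ≤ Q x y) (y : V)
    (hD : ∀ x, |A x y - 1 / Fintype.card V| ≤ D) (x : V) :
    |(Q * A) x y - 1 / Fintype.card V| ≤ (1 - c) * D := by
  rw [mem_doublyStochastic_iff_sum] at hQ hA
  have hn : (Fintype.card V : ℝ) ≠ 0 := by
    have : Nonempty V := ⟨x⟩
    exact_mod_cast Fintype.card_ne_zero
  have h0 : ∑ z, (A z y - 1 / Fintype.card V) = 0 := by
    rw [Finset.sum_sub_distrib, hA.2.2 y]
    simp [hn]
  have h1 : (Q * A) x y - 1 / Fintype.card V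
      = ∑ z, (Q x z - c / Fintype.card V) * (A z y - 1 / Fintype.card V) := by
    simp only [sub_mul (Q x _)]
    rw [Finset.sum_sub_distrib, ← Finset.mul_sum, h0, mul_zero, sub_zero]
    simp only [mul_sub]
    rw [Finset.sum_sub_distrib, ← Finset.sum_mul, hQ.2.1 x, one_mul, Matrix.mul_apply]
  rw [h1]
  calc _ ≤ ∑ z, |(Q x z - c / Fintype.card V) * (A z y - 1 / Fintype.card V)| :=
        Finset.abs_sum_le_sum_abs _ _
    _ ≤ ∑ z, (Q x z - c / Fintype.card V) * D := by
        refine Finset.sum_le_sum fun z _ => ?_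
        have := sub_nonneg.2 (hc x z)
        rw [abs_mul, abs_of_nonneg this]
        exact mul_le_mul_of_nonneg_left (hD z) this
    _ = (1 - c) * D := by
        rw [← Finset.sum_mul, Finset.sum_sub_distrib, hQ.2.1 x]
        simp [mul_div_cancel₀ _ hn]

/-- The vertices from which the walk of length `k` ends at `y` with probability at least `a`. -/
noncomputable def heavy (G : SimpleGraph V) [DecidableRel G.Adj] (d : ℕ) (σ : Equiv.Perm V)
    (y : V) (k : ℕ) (a : ℝ) : Finset V :=
  {x | a ≤ (walk G d σ ^ k) x y}

theorem mem_heavy_succ (hd : 0 < d) (hreg : ∀ x, (G.neighborFinset x).card = d) {y : V} {k : ℕ}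
    {a b : ℝ} (ha : 0 ≤ a) {x : V}
    (hx : b * d ≤ (#{w ∈ G.neighborFinset x | σ w ∈ heavy G d σ y k a} : ℝ)) :
    x ∈ heavy G d σ y (k + 1) (b * a) := by
  have hd' : (0 : ℝ) < d := by exact_mod_cast hd
  simp only [heavy, Finset.mem_filter, Finset.mem_univ, true_and] at hx ⊢
  rw [walk_pow_succ_apply, inv_mul_eq_div, le_div_iff₀ hd']
  calc b * a * d = (b * d) * a := by ring
    _ ≤ (#{w ∈ G.neighborFinset x | a ≤ (walk G d σ ^ k) (σ w) y} : ℝ) * a := by gcongr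
    _ ≤ ∑ w ∈ G.neighborFinset x with a ≤ (walk G d σ ^ k) (σ w) y, (walk G d σ ^ k) (σ w) y := by
        rw [← nsmul_eq_mul]
        refine Finset.card_nsmul_le_sum _ _ _ fun w hw => ?_
        exact (Finset.mem_filter.1 hw).2
    _ ≤ _ := Finset.sum_le_sum_of_subset_of_nonneg (Finset.filter_subset _ _)
        fun w _ _ => walk_pow_nonneg σ hd hreg k _ _

theorem heavy_succ_eq_univ (hd : 0 < d) (hreg : ∀ x, (G.neighborFinset x).card = d) {y : V}
    {k : ℕ} {a b : ℝ} (ha : 0 ≤ a) (hb : b ≤ 1 / 2)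
    (h : (Fintype.card V : ℝ) - d / 2 ≤ #(heavy G d σ y k a)) :
    heavy G d σ y (k + 1) (b * a) = Finset.univ := by
  refine Finset.eq_univ_of_forall fun x => mem_heavy_succ σ hd hreg ha ?_
  have h1 := Finset.card_filter_add_card_filter_not (s := G.neighborFinset x)
    (fun w => σ w ∈ heavy G d σ y k a)
  have h2 : #{w ∈ G.neighborFinset x | ¬ σ w ∈ heavy G d σ y k a} ≤ #(heavy G d σ y k a)ᶜ := by
    refine Finset.card_le_card_of_injOn σ (fun w hw => ?_) σ.injective.injOn
    simpa using (Finset.mem_filter.1 hw).2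
  have h3 := Finset.card_add_card_compl (heavy G d σ y k a)
  rw [hreg] at h1
  rify at h1 h2 h3
  have : b * d ≤ 1 / 2 * d := by gcongr
  linarith

theorem card_heavy_succ {ν τ : ℝ} (hd : 0 < d) (hreg : ∀ x, (G.neighborFinset x).card = d)
    (hexp : RobustExpander G ν τ) {y : V} {k : ℕ} {a b : ℝ} (ha : 0 ≤ a) (hb : b ≤ ν) (hν : 0 ≤ ν)
    (hdn : d ≤ Fintype.card V)
    (h1 : τ * (Fintype.card V : ℝ) ≤ #(heavy G d σ y k a))
    (h2 : (#(heavy G d σ y k a) : ℝ) ≤ (1 - τ) * Fintype.card V) :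
    (#(heavy G d σ y k a) : ℝ) + ν * Fintype.card V ≤ #(heavy G d σ y (k + 1) (b * a)) := by
  set S : Finset V := (heavy G d σ y k a).map σ⁻¹.toEmbedding with hS
  have hSc : Nat.card (S : Set V) = #(heavy G d σ y k a) := by
    rw [Nat.card_coe_set_eq, Set.ncard_coe_finset, hS, Finset.card_map]
  have := hexp (S : Set V) (by rwa [hSc]) (by rwa [hSc])
  rw [hSc] at this
  refine this.trans ?_
  have hsub : RN G ν (S : Set V) ⊆ (heavy G d σ y (k + 1) (b * a) : Set V) := by
    intro x hx
    refine mem_heavy_succ σ hd hreg ha ?_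
    have h3 : Nat.card {u : V | u ∈ (S : Set V) ∧ G.Adj x u}
        = #{w ∈ G.neighborFinset x | σ w ∈ heavy G d σ y k a} := by
      rw [Nat.card_coe_set_eq, ← Set.ncard_coe_finset]
      congr 1
      ext u
      simp [hS, and_comm]
    have h4 : ν * (Fintype.card V : ℝ) ≤ _ := hx
    rw [h3] at h4
    refine le_trans ?_ h4
    gcongr
  have h5 := Nat.card_mono (Finset.finite_toSet _) hsub
  rw [Nat.card_coe_set_eq (heavy G d σ y (k + 1) (b * a) : Set V), Set.ncard_coe_finset] at h5
  exact_mod_cast h5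

theorem card_heavy_ge {ν δ b : ℝ} (hd : 0 < d) (hreg : ∀ x, (G.neighborFinset x).card = d)
    (hδ : δ * Fintype.card V ≤ d) (hexp : RobustExpander G ν (δ / 2)) (hb0 : 0 ≤ b)
    (hb : b ≤ 1 / 2) (hbν : b ≤ ν) (hdn : d ≤ Fintype.card V) (y : V) (k : ℕ) :
    δ / 2 * (Fintype.card V : ℝ) ≤ #(heavy G d σ y (k + 1) (b ^ k * (d : ℝ)⁻¹)) ∧
      min (Fintype.card V : ℝ) (k * ν * Fintype.card V)
        ≤ #(heavy G d σ y (k + 1) (b ^ k * (d : ℝ)⁻¹)) := by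
  have hdn' : (d : ℝ) ≤ Fintype.card V := by exact_mod_cast hdn
  have hd' : (0 : ℝ) < d := by exact_mod_cast hd
  induction k with
  | zero =>
    have h : heavy G d σ y (0 + 1) (b ^ 0 * (d : ℝ)⁻¹)
        = (G.neighborFinset (σ⁻¹ y)) := by
      ext x
      simp only [heavy, walk, zero_add, pow_one, pow_zero, one_mul, Finset.mem_filter,
        Finset.mem_univ, true_and, SimpleGraph.mem_neighborFinset]
      rw [G.adj_comm (σ⁻¹ y)]
      split_ifs with h
      · simpa using h
      · simp only [h, iff_false, not_le]
        positivity
    rw [h, hreg]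
    refine ⟨by linarith, (min_le_right _ _).trans ?_⟩
    simp
  | succ k ih =>
    have ha : 0 ≤ b ^ k * (d : ℝ)⁻¹ := by positivity
    have heq : b ^ (k + 1) * (d : ℝ)⁻¹ = b * (b ^ k * (d : ℝ)⁻¹) := by ring
    rw [heq]
    by_cases h2 : (#(heavy G d σ y (k + 1) (b ^ k * (d : ℝ)⁻¹)) : ℝ)
        ≤ (1 - δ / 2) * Fintype.card V
    · have hν : 0 ≤ ν := hb0.trans hbν
      have := card_heavy_succ σ hd hreg hexp ha hbν hν hdn ih.1 h2
      have hpos : 0 ≤ ν * Fintype.card V := by positivity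
      refine ⟨by linarith [ih.1], ?_⟩
      push_cast
      rcases min_le_iff.1 ih.2 with h | h
      · exact (min_le_left _ _).trans (by linarith)
      · exact (min_le_right _ _).trans (by linarith)
    · push Not at h2
      rw [heavy_succ_eq_univ σ hd hreg ha hb (by linarith), Finset.card_univ]
      exact ⟨by linarith, min_le_left _ _⟩

theorem le_walk_pow {ν δ b : ℝ} (hd : 0 < d) (hreg : ∀ x, (G.neighborFinset x).card = d)
    (hδ : δ * Fintype.card V ≤ d) (hexp : RobustExpander G ν (δ / 2)) (hb0 : 0 ≤ b)
    (hb : b ≤ 1 / 2) (hbν : b ≤ ν) (hdn : d ≤ Fintype.card V) {k : ℕ} (hk : 1 ≤ k * ν) (x y : V) :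
    b ^ k / Fintype.card V ≤ (walk G d σ ^ (k + 1)) x y := by
  have hd' : (0 : ℝ) < d := by exact_mod_cast hd
  have h := (card_heavy_ge σ hd hreg hδ hexp hb0 hb hbν hdn y k).2
  rw [min_eq_left (le_mul_of_one_le_left (by positivity) hk)] at h
  have h1 : heavy G d σ y (k + 1) (b ^ k * (d : ℝ)⁻¹) = Finset.univ := by
    rw [← Finset.card_eq_iff_eq_univ]
    exact le_antisymm (Finset.card_le_univ _) (by exact_mod_cast h)
  have h2 : x ∈ heavy G d σ y (k + 1) (b ^ k * (d : ℝ)⁻¹) := h1 ▸ Finset.mem_univ x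
  refine le_trans ?_ (Finset.mem_filter.1 h2).2
  rw [div_eq_mul_inv]
  gcongr

end Walk

/-- Rapid mixing: after a bounded number of steps, the walk in a dense regular robust expander is
almost uniformly distributed. -/
theorem exists_walk_mixing {δ ν ξ : ℝ} (hδ : 0 < δ) (hν : 0 < ν) (hξ : 0 < ξ) :
    ∃ L : ℕ, 1 ≤ L ∧ ∀ (V : Type) [Fintype V] [DecidableEq V] (G : SimpleGraph V)
      [DecidableRel G.Adj] (d : ℕ), 0 < d → (∀ x, (G.neighborFinset x).card = d) →
      δ * Fintype.card V ≤ d → RobustExpander G ν (δ / 2) → ∀ (σ : Equiv.Perm V) (x y : V),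
      |(walk G d σ ^ L) x y - 1 / Fintype.card V| ≤ ξ / Fintype.card V := by
  set b := min ν (1 / 2) with hb
  have hb0 : 0 < b := by positivity
  obtain ⟨k, hk⟩ := exists_nat_ge (1 / ν)
  have hk : 1 ≤ k * ν := by rwa [div_le_iff₀ hν] at hk
  set c := b ^ k with hc
  have hc0 : 0 < c := by positivity
  have hc1 : c ≤ 1 := pow_le_one₀ hb0.le ((min_le_right _ _).trans (by norm_num))
  obtain ⟨t, ht⟩ := exists_pow_lt_of_lt_one (show 0 < ξ * δ by positivity)
    (show 1 - c < 1 by linarith)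
  refine ⟨t * (k + 1) + 1, by omega, ?_⟩
  intro V _ _ G _ d hd hreg hδd hexp σ x y
  have hd' : (0 : ℝ) < d := by exact_mod_cast hd
  have hdn : d ≤ Fintype.card V := by
    rw [← hreg x]; exact Finset.card_le_univ _
  have hdn' : (d : ℝ) ≤ Fintype.card V := by exact_mod_cast hdn
  have hn : (0 : ℝ) < Fintype.card V := hd'.trans_le hdn'
  have key : ∀ s : ℕ, ∀ x, |(walk G d σ ^ (s * (k + 1) + 1)) x y - 1 / Fintype.card V|
      ≤ (1 - c) ^ s * (d : ℝ)⁻¹ := by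
    intro s
    induction s with
    | zero =>
      intro x
      have h1 := walk_apply_le (G := G) (d := d) σ x y
      have h2 := walk_pow_nonneg (G := G) σ hd hreg 1 x y
      have h3 : 1 / (Fintype.card V : ℝ) ≤ (d : ℝ)⁻¹ := by
        rw [one_div]; gcongr
      have h4 : 0 ≤ 1 / (Fintype.card V : ℝ) := by positivity
      simp only [zero_mul, zero_add, pow_one, pow_zero, one_mul] at h2 ⊢
      rw [abs_le]
      constructor <;> linarith
    | succ s ih =>
      intro x
      have := doublyStochastic_contract (walk_pow_mem σ hd hreg (k + 1))
        (walk_pow_mem σ hd hreg (s * (k + 1) + 1)) (c := c)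
        (le_walk_pow σ hd hreg hδd hexp hb0.le (min_le_right _ _) (min_le_left _ _) hdn hk) y ih x
      rw [← pow_add] at this
      rw [show (s + 1) * (k + 1) + 1 = k + 1 + (s * (k + 1) + 1) by ring]
      exact this.trans_eq (by ring)
  refine (key t x).trans ?_
  rw [← div_eq_mul_inv, div_le_div_iff₀ hd' hn]
  calc (1 - c) ^ t * Fintype.card V ≤ ξ * δ * Fintype.card V := by gcongr
    _ = ξ * (δ * Fintype.card V) := by ring
    _ ≤ ξ * d := by gcongr
section Rotation

variable {V : Type*}

/-- `σ` encodes a perfect matching on `V` which agrees with `ρ` on `F` and all of whose edges,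
except possibly the one at `v`, are edges of `G`. -/
structure IsNear (G : SimpleGraph V) (v : V) (ρ : Equiv.Perm V) (F : Finset V)
    (σ : Equiv.Perm V) : Prop where
  invol : ∀ x, σ (σ x) = x
  ne_self : ∀ x, σ x ≠ x
  adj : ∀ x, x ≠ v → x ≠ σ v → G.Adj x (σ x)
  eq_on : ∀ x ∈ F, σ x = ρ x

/-- Replace the edges `{v, σ v}` and `{w, σ w}` of `σ` by `{v, σ w}` and `{w, σ v}`. -/
def rot [DecidableEq V] (v w : V) (σ : Equiv.Perm V) : Equiv.Perm V :=
  Equiv.swap (σ v) (σ w) * σ * Equiv.swap (σ v) (σ w)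

variable {G : SimpleGraph V} {v w y : V} {ρ : Equiv.Perm V} {F : Finset V}
  {σ : Equiv.Perm V}

theorem IsNear.inv_eq (h : IsNear G v ρ F σ) : σ⁻¹ = σ := by
  rw [inv_eq_iff_mul_eq_one]
  ext x
  simp [h.invol]

theorem IsNear.apply_notMem (h : IsNear G v ρ F σ) (hF : ∀ x ∈ F, ρ x ∈ F) {x : V} (hx : x ∉ F) :
    σ x ∉ F := by
  intro hs
  have := h.eq_on _ hs
  rw [h.invol] at this
  exact hx (this ▸ hF _ hs)

variable [DecidableEq V]

theorem IsNear.rot_apply_left (h : IsNear G v ρ F σ) (hw : w ≠ σ v) : rot v w σ v = σ w := by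
  have h1 : v ≠ σ w := fun h' => hw (by rw [h', h.invol])
  simp [rot, Equiv.swap_apply_of_ne_of_ne (h.ne_self v).symm h1]

theorem IsNear.rot_apply_right (h : IsNear G v ρ F σ) (hw : w ≠ σ v) : rot v w σ w = σ v := by
  simp [rot, Equiv.swap_apply_of_ne_of_ne hw (h.ne_self w).symm]

theorem IsNear.rot_apply_apply_left (h : IsNear G v ρ F σ) (hw : w ≠ σ v) :
    rot v w σ (σ v) = w := by
  simp [rot, h.invol, Equiv.swap_apply_of_ne_of_ne hw (h.ne_self w).symm]

theorem IsNear.rot_apply_of_ne (_ : IsNear G v ρ F σ) {x : V} (h1 : x ≠ v) (h2 : x ≠ w)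
    (h3 : x ≠ σ v) (h4 : x ≠ σ w) : rot v w σ x = σ x := by
  have h5 : σ x ≠ σ v := fun h' => h1 (σ.injective h')
  have h6 : σ x ≠ σ w := fun h' => h2 (σ.injective h')
  simp [rot, Equiv.swap_apply_of_ne_of_ne h3 h4, Equiv.swap_apply_of_ne_of_ne h5 h6]

theorem IsNear.rot_rot (h : IsNear G v ρ F σ) (hw : w ≠ σ v) : rot v w (rot v w σ) = σ := by
  rw [rot, h.rot_apply_left hw, h.rot_apply_right hw, rot, Equiv.swap_comm (σ w) (σ v)]
  ext x
  simp

theorem IsNear.rot (h : IsNear G v ρ F σ) (hF : ∀ x ∈ F, ρ x ∈ F) (hv : v ∉ F)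
    (hw : G.Adj (σ v) w) (hwF : w ∉ F) : IsNear G v ρ F (rot v w σ) := by
  have hne : w ≠ σ v := hw.ne'
  refine ⟨fun x => ?_, fun x hx => ?_, fun x h1 h2 => ?_, fun x hx => ?_⟩
  · simp [RPM.rot, h.invol]
  · rw [RPM.rot, Equiv.Perm.mul_apply, Equiv.Perm.mul_apply, Equiv.swap_apply_eq_iff] at hx
    exact h.ne_self _ hx
  · rw [h.rot_apply_left hne] at h2
    by_cases h3 : x = σ v
    · rw [h3, h.rot_apply_apply_left hne]
      exact hw
    · by_cases h4 : x = w
      · rw [h4, h.rot_apply_right hne]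
        exact hw.symm
      · rw [h.rot_apply_of_ne h1 h4 h3 h2]
        exact h.adj x h1 h3
  · have h1 : x ≠ v := fun h' => hv (h' ▸ hx)
    have h2 : x ≠ w := fun h' => hwF (h' ▸ hx)
    have h3 : x ≠ σ v := fun h' => h.apply_notMem hF hv (h' ▸ hx)
    have h4 : x ≠ σ w := fun h' => h.apply_notMem hF hwF (h' ▸ hx)
    rw [h.rot_apply_of_ne h1 h2 h3 h4, h.eq_on x hx]

variable [Fintype V] [DecidableRel G.Adj]

open Classical in
/-- The finset of all permutations satisfying `IsNear`. -/
noncomputable def nearSet (G : SimpleGraph V) (v : V) (ρ : Equiv.Perm V) (F : Finset V) :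
    Finset (Equiv.Perm V) :=
  {σ | IsNear G v ρ F σ}

omit [DecidableRel G.Adj] in
theorem mem_nearSet : σ ∈ nearSet G v ρ F ↔ IsNear G v ρ F σ := by
  simp [nearSet]

/-- The averaging operator of the random rotation chain, where rotations at `F` are
suppressed. -/
noncomputable def rotStep (G : SimpleGraph V) [DecidableRel G.Adj] (d : ℕ) (v : V) (F : Finset V)
    (f : Equiv.Perm V → ℝ) (σ : Equiv.Perm V) : ℝ :=
  (d : ℝ)⁻¹ * ∑ w ∈ G.neighborFinset (σ v) with w ∉ F, f (rot v w σ)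

theorem rotStep_symm (d : ℕ) (hF : ∀ x ∈ F, ρ x ∈ F) (hv : v ∉ F) (f g : Equiv.Perm V → ℝ) :
    ∑ σ ∈ nearSet G v ρ F, f σ * rotStep G d v F g σ
      = ∑ σ ∈ nearSet G v ρ F, rotStep G d v F f σ * g σ := by
  have h1 : ∀ σ, f σ * rotStep G d v F g σ
      = (d : ℝ)⁻¹ * ∑ w ∈ G.neighborFinset (σ v) with w ∉ F, f σ * g (rot v w σ) := by
    intro σ; rw [rotStep, ← Finset.mul_sum]; ring
  have h2 : ∀ σ, rotStep G d v F f σ * g σ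
      = (d : ℝ)⁻¹ * ∑ w ∈ G.neighborFinset (σ v) with w ∉ F, f (rot v w σ) * g σ := by
    intro σ; rw [rotStep, ← Finset.sum_mul]; ring
  simp only [h1, h2]
  rw [← Finset.mul_sum, ← Finset.mul_sum]
  congr 1
  rw [Finset.sum_sigma', Finset.sum_sigma']
  have hmem : ∀ a ∈ (nearSet G v ρ F).sigma fun σ => {w ∈ G.neighborFinset (σ v) | w ∉ F},
      (⟨rot v a.2 a.1, a.2⟩ : (_ : Equiv.Perm V) × V) ∈
        (nearSet G v ρ F).sigma fun σ => {w ∈ G.neighborFinset (σ v) | w ∉ F} := by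
    rintro ⟨σ, w⟩ ha
    simp only [Finset.mem_sigma, mem_nearSet, Finset.mem_filter,
      SimpleGraph.mem_neighborFinset] at ha ⊢
    obtain ⟨hσ, hw, hwF⟩ := ha
    refine ⟨hσ.rot hF hv hw hwF, ?_, hwF⟩
    rw [hσ.rot_apply_left hw.ne']
    by_cases hwv : w = v
    · rw [hwv] at hw ⊢; exact hw
    · exact (hσ.adj w hwv hw.ne').symm
  have hinv : ∀ a ∈ (nearSet G v ρ F).sigma fun σ => {w ∈ G.neighborFinset (σ v) | w ∉ F},
      (⟨rot v a.2 (rot v a.2 a.1), a.2⟩ : (_ : Equiv.Perm V) × V) = a := by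
    rintro ⟨σ, w⟩ ha
    simp only [Finset.mem_sigma, mem_nearSet, Finset.mem_filter,
      SimpleGraph.mem_neighborFinset] at ha
    rw [ha.1.rot_rot ha.2.1.ne']
  refine Finset.sum_nbij' (fun a => ⟨rot v a.2 a.1, a.2⟩) (fun a => ⟨rot v a.2 a.1, a.2⟩)
    hmem hmem hinv hinv ?_
  rintro ⟨σ, w⟩ ha
  have := hinv _ ha
  simp only [Sigma.mk.injEq, heq_eq_eq, and_true] at this
  simp only [this]

theorem rotStep_iterate_symm (d : ℕ) (hF : ∀ x ∈ F, ρ x ∈ F) (hv : v ∉ F)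
    (f g : Equiv.Perm V → ℝ) (t : ℕ) :
    ∑ σ ∈ nearSet G v ρ F, f σ * (rotStep G d v F)^[t] g σ
      = ∑ σ ∈ nearSet G v ρ F, (rotStep G d v F)^[t] f σ * g σ := by
  induction t generalizing f with
  | zero => rfl
  | succ t ih =>
    rw [Function.iterate_succ_apply', rotStep_symm d hF hv, ih, ← Function.iterate_succ_apply]

theorem card_neighborFinset_filter_ge {d : ℕ} (hreg : ∀ x, (G.neighborFinset x).card = d) (x : V) :
    (d : ℝ) - #F ≤ #{w ∈ G.neighborFinset x | w ∉ F} := by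
  have h1 := Finset.card_filter_add_card_filter_not (s := G.neighborFinset x) (· ∈ F)
  have h2 : #{w ∈ G.neighborFinset x | w ∈ F} ≤ #F :=
    Finset.card_le_card fun w hw => (Finset.mem_filter.1 hw).2
  rw [hreg] at h1
  rify at h1 h2
  linarith

theorem rotStep_iterate_one_le {d : ℕ} (hd : 0 < d) (hreg : ∀ x, (G.neighborFinset x).card = d)
    (t : ℕ) (σ : Equiv.Perm V) : (rotStep G d v F)^[t] (fun _ => 1) σ ≤ 1 := by
  induction t generalizing σ with
  | zero => simp
  | succ t ih =>
    have hd' : (0 : ℝ) < d := by exact_mod_cast hd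
    rw [Function.iterate_succ_apply', rotStep, inv_mul_le_iff₀ hd', mul_one]
    calc _ ≤ ∑ w ∈ G.neighborFinset (σ v) with w ∉ F, (1 : ℝ) :=
          Finset.sum_le_sum fun w _ => ih _
      _ = #{w ∈ G.neighborFinset (σ v) | w ∉ F} := by simp
      _ ≤ d := by
        rw [← hreg (σ v)]
        exact_mod_cast Finset.card_filter_le _ _

theorem le_rotStep_iterate_one {d : ℕ} (hd : 0 < d) (hreg : ∀ x, (G.neighborFinset x).card = d)
    (hFd : #F ≤ d) (t : ℕ) (σ : Equiv.Perm V) :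
    (1 - (#F : ℝ) / d) ^ t ≤ (rotStep G d v F)^[t] (fun _ => 1) σ := by
  induction t generalizing σ with
  | zero => simp
  | succ t ih =>
    have hd' : (0 : ℝ) < d := by exact_mod_cast hd
    have hFd' : (#F : ℝ) ≤ d := by exact_mod_cast hFd
    have h0 : 0 ≤ 1 - (#F : ℝ) / d := by
      rw [sub_nonneg, div_le_one hd']; exact hFd'
    rw [Function.iterate_succ_apply', rotStep, ← div_eq_inv_mul, le_div_iff₀ hd']
    calc (1 - (#F : ℝ) / d) ^ (t + 1) * d = (d - #F) * (1 - (#F : ℝ) / d) ^ t := by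
          have : (1 - (#F : ℝ) / d) * d = d - #F := by field_simp
          rw [pow_succ, mul_assoc, this, mul_comm]
      _ ≤ #{w ∈ G.neighborFinset (σ v) | w ∉ F} * (1 - (#F : ℝ) / d) ^ t := by
          gcongr
          exact card_neighborFinset_filter_ge hreg _
      _ ≤ _ := by
          rw [← nsmul_eq_mul]
          exact Finset.card_nsmul_le_sum _ _ _ fun w _ => ih _

/-- Changing the permutation at few vertices has little effect on the walk. -/
theorem abs_walk_pow_sub_le {d : ℕ} (hd : 0 < d) (hreg : ∀ x, (G.neighborFinset x).card = d)
    (σ σ' : Equiv.Perm V) {m : ℕ} (hm : #{w | σ' w ≠ σ w} ≤ m) (t : ℕ) (x y : V) :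
    |(walk G d σ' ^ (t + 1)) x y - (walk G d σ ^ (t + 1)) x y|
      ≤ (m : ℝ) * t / d ^ 2 + if σ'⁻¹ y ≠ σ⁻¹ y then (d : ℝ)⁻¹ else 0 := by
  have hd' : (0 : ℝ) < d := by exact_mod_cast hd
  induction t generalizing x with
  | zero =>
    simp only [zero_add, pow_one, walk]
    by_cases h : σ'⁻¹ y = σ⁻¹ y
    · simp [h]
    · rw [if_pos h]
      split_ifs <;> simp
  | succ t ih =>
    rw [walk_pow_succ_apply, walk_pow_succ_apply G σ, ← mul_sub, ← Finset.sum_sub_distrib, abs_mul,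
      abs_of_pos (inv_pos.2 hd'), inv_mul_le_iff₀ hd']
    set q : ℝ := if σ'⁻¹ y ≠ σ⁻¹ y then (d : ℝ)⁻¹ else 0
    calc _ ≤ ∑ w ∈ G.neighborFinset x,
          |(walk G d σ' ^ (t + 1)) (σ' w) y - (walk G d σ ^ (t + 1)) (σ w) y| :=
          Finset.abs_sum_le_sum_abs _ _
      _ ≤ ∑ w ∈ G.neighborFinset x,
          (((m : ℝ) * t / d ^ 2 + q) + if σ' w ≠ σ w then (d : ℝ)⁻¹ else 0) := by
          refine Finset.sum_le_sum fun w _ => ?_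
          refine (abs_sub_le _ ((walk G d σ ^ (t + 1)) (σ' w) y) _).trans ?_
          refine add_le_add (ih _) ?_
          by_cases h : σ' w = σ w
          · simp [h]
          · rw [if_pos h]
            have h1 := walk_pow_nonneg (G := G) σ hd hreg (t + 1) (σ' w) y
            have h2 := walk_pow_nonneg (G := G) σ hd hreg (t + 1) (σ w) y
            have h3 := walk_pow_le (G := G) σ hd hreg (k := t + 1) (by omega) (σ' w) y
            have h4 := walk_pow_le (G := G) σ hd hreg (k := t + 1) (by omega) (σ w) y
            rw [abs_le]; constructor <;> linarith
      _ = d * ((m : ℝ) * t / d ^ 2 + q)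
            + #{w ∈ G.neighborFinset x | σ' w ≠ σ w} * (d : ℝ)⁻¹ := by
          rw [Finset.sum_add_distrib, Finset.sum_const, hreg, nsmul_eq_mul, ← Finset.sum_filter,
            Finset.sum_const, nsmul_eq_mul]
      _ ≤ d * ((m : ℝ) * t / d ^ 2 + q) + m * (d : ℝ)⁻¹ := by
          gcongr
          exact (Finset.card_le_card (Finset.filter_subset_filter _ (Finset.subset_univ _))).trans hm
      _ = _ := by
          push_cast
          field_simp
          ring

omit [DecidableRel G.Adj] in
theorem IsNear.card_rot_ne_le (h : IsNear G v ρ F σ) (w : V) :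
    #{x | RPM.rot v w σ x ≠ σ x} ≤ 4 := by
  have hsub : ({x | RPM.rot v w σ x ≠ σ x} : Finset V) ⊆ {v, w, σ v, σ w} := by
    intro x hx
    simp only [Finset.mem_filter, Finset.mem_univ, true_and] at hx
    by_contra hc
    simp only [Finset.mem_insert, Finset.mem_singleton, not_or] at hc
    exact hx (h.rot_apply_of_ne hc.1 hc.2.1 hc.2.2.1 hc.2.2.2)
  exact (Finset.card_le_card hsub).trans Finset.card_le_four

theorem rotStep_indicator {d : ℕ} (hF : ∀ x ∈ F, ρ x ∈ F) (h : IsNear G v ρ F σ) (hy : y ∉ F) :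
    rotStep G d v F (fun σ => if σ v = y then 1 else 0) σ = walk G d σ (σ v) y := by
  have h1 : ∀ w ∈ ({w ∈ G.neighborFinset (σ v) | w ∉ F} : Finset V),
      (if rot v w σ v = y then (1 : ℝ) else 0) = if σ y = w then 1 else 0 := by
    intro w hw
    simp only [Finset.mem_filter, SimpleGraph.mem_neighborFinset] at hw
    rw [h.rot_apply_left hw.1.ne']
    refine if_congr ⟨fun h' => ?_, fun h' => ?_⟩ rfl rfl
    · rw [← h', h.invol]
    · rw [← h', h.invol]
  rw [rotStep, Finset.sum_congr rfl h1, Finset.sum_ite_eq]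
  simp [walk, h.inv_eq, h.apply_notMem hF hy]

end Rotation
section Tracking

variable {V : Type*} [Fintype V] [DecidableEq V] {G : SimpleGraph V} [DecidableRel G.Adj]
  {v y : V} {ρ : Equiv.Perm V} {F : Finset V} {σ : Equiv.Perm V}

/-- The probability that `t` steps of the rotation chain end at a permutation mapping `v`
to `y`. -/
noncomputable def rotProb (G : SimpleGraph V) [DecidableRel G.Adj] (d : ℕ) (v : V) (F : Finset V)
    (y : V) (t : ℕ) : Equiv.Perm V → ℝ :=
  (rotStep G d v F)^[t] (fun σ => if σ v = y then 1 else 0)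

theorem rotProb_succ (d t : ℕ) (σ : Equiv.Perm V) :
    rotProb G d v F y (t + 1) σ = rotStep G d v F (rotProb G d v F y t) σ := by
  rw [rotProb, Function.iterate_succ_apply']
  rfl

theorem abs_rotStep_sub_le {d : ℕ} (hd : 0 < d) (f : Equiv.Perm V → ℝ) (g B : V → ℝ)
    (hfg : ∀ w ∈ G.neighborFinset (σ v),
      |(if w ∉ F then f (rot v w σ) else 0) - g w| ≤ B w) :
    |rotStep G d v F f σ - (d : ℝ)⁻¹ * ∑ w ∈ G.neighborFinset (σ v), g w|
      ≤ (d : ℝ)⁻¹ * ∑ w ∈ G.neighborFinset (σ v), B w := by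
  have hd' : (0 : ℝ) < d := by exact_mod_cast hd
  rw [rotStep, Finset.sum_filter, ← mul_sub, ← Finset.sum_sub_distrib, abs_mul,
    abs_of_pos (inv_pos.2 hd')]
  gcongr
  exact (Finset.abs_sum_le_sum_abs _ _).trans (Finset.sum_le_sum hfg)

omit [Fintype V] [DecidableEq V] in
theorem sum_indicator_le (s : Finset V) (p : V → Prop) [DecidablePred p] {c : ℝ} (hc : 0 ≤ c)
    {m : ℕ} (hp : #{w ∈ s | p w} ≤ m) : ∑ w ∈ s, (if p w then c else 0) ≤ m * c := by
  rw [← Finset.sum_filter, Finset.sum_const, nsmul_eq_mul]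
  gcongr

omit [Fintype V] in
theorem card_filter_apply_eq_le_one (s : Finset V) (σ : Equiv.Perm V) (y : V) :
    #{w ∈ s | σ w = y} ≤ 1 := by
  rw [Finset.card_le_one]
  intro a ha b hb
  exact σ.injective ((Finset.mem_filter.1 ha).2.trans (Finset.mem_filter.1 hb).2.symm)

/-- The rotation chain started at `σ` follows the walk given by `σ` itself, up to an error of
order `d⁻²`, unless it starts at its target. -/
theorem abs_rotProb_sub_walk_le {d : ℕ} (hd : 0 < d)
    (hreg : ∀ x, (G.neighborFinset x).card = d) (hF : ∀ x ∈ F, ρ x ∈ F) (hv : v ∉ F)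
    (hy : y ∉ F) (hyv : y ≠ v) (t : ℕ) (hσ : IsNear G v ρ F σ) :
    |rotProb G d v F y (t + 1) σ - (walk G d σ ^ (t + 1)) (σ v) y|
      ≤ (t * (4 * t + 3 + #F) : ℝ) / d ^ 2 + if σ v = y then (d : ℝ)⁻¹ else 0 := by
  have hd' : (0 : ℝ) < d := by exact_mod_cast hd
  induction t generalizing σ with
  | zero =>
    have h1 : rotProb G d v F y (0 + 1) σ = walk G d σ (σ v) y := by
      rw [← rotStep_indicator hF hσ hy]
      rfl
    rw [h1]
    simp only [zero_add, pow_one, sub_self, abs_zero, CharP.cast_eq_zero, zero_mul, zero_div]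
    positivity
  | succ t ih =>
    set α : ℝ := (t * (4 * t + 3 + #F) : ℝ) / d ^ 2 with hα
    set β : ℝ := (4 * t : ℝ) / d ^ 2 with hβ
    have hα0 : 0 ≤ α := by positivity
    have hβ0 : 0 ≤ β := by positivity
    rw [rotProb_succ, walk_pow_succ_apply]
    refine (abs_rotStep_sub_le hd _ _ (fun w => (α + β + if σ v = y then (d : ℝ)⁻¹ else 0)
      + ((if w ∈ F then (d : ℝ)⁻¹ else 0) + (if σ w = y then (d : ℝ)⁻¹ else 0)
      + ((if w = y then (d : ℝ)⁻¹ else 0) + (if σ w = y then (d : ℝ)⁻¹ else 0))))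
      fun w hw => ?_).trans ?_
    · rw [SimpleGraph.mem_neighborFinset] at hw
      have hd0 : 0 ≤ (d : ℝ)⁻¹ := by positivity
      have i0 : ∀ p : Prop, [Decidable p] → 0 ≤ (if p then (d : ℝ)⁻¹ else 0) := by
        intro p _; split_ifs <;> positivity
      by_cases hwF : w ∈ F
      · simp only [hwF, not_true, if_false, if_true, zero_sub, abs_neg]
        rw [abs_of_nonneg (walk_pow_nonneg σ hd hreg _ _ _)]
        have := walk_pow_le (G := G) σ hd hreg (k := t + 1) (by omega) (σ w) y
        linarith [i0 (σ v = y), i0 (σ w = y), i0 (w = y)]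
      · simp only [hwF, not_false_eq_true, if_true, if_false]
        have hσ' := hσ.rot hF hv hw hwF
        have h1 := ih hσ'
        rw [hσ.rot_apply_left hw.ne'] at h1
        have h2 := abs_walk_pow_sub_le hd hreg σ (rot v w σ) (hσ.card_rot_ne_le w) t (σ w) y
        rw [hσ.inv_eq, hσ'.inv_eq] at h2
        have h3 : (if rot v w σ y ≠ σ y then (d : ℝ)⁻¹ else 0) ≤ (if σ v = y then (d : ℝ)⁻¹ else 0)
            + ((if w = y then (d : ℝ)⁻¹ else 0) + (if σ w = y then (d : ℝ)⁻¹ else 0)) := by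
          by_cases c1 : σ v = y
          · rw [if_pos c1]
            have : (if rot v w σ y ≠ σ y then (d : ℝ)⁻¹ else 0) ≤ (d : ℝ)⁻¹ := by
              split_ifs <;> simp
            linarith [i0 (σ w = y), i0 (w = y)]
          by_cases c2 : w = y
          · rw [if_pos c2]
            have : (if rot v w σ y ≠ σ y then (d : ℝ)⁻¹ else 0) ≤ (d : ℝ)⁻¹ := by
              split_ifs <;> simp
            linarith [i0 (σ w = y), i0 (σ v = y)]
          by_cases c3 : σ w = y
          · rw [if_pos c3]
            have : (if rot v w σ y ≠ σ y then (d : ℝ)⁻¹ else 0) ≤ (d : ℝ)⁻¹ := by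
              split_ifs <;> simp
            linarith [i0 (w = y), i0 (σ v = y)]
          rw [if_neg (not_not.2 (hσ.rot_apply_of_ne hyv (Ne.symm c2) (Ne.symm c1) (Ne.symm c3)))]
          linarith [i0 (w = y), i0 (σ v = y), i0 (σ w = y)]
        refine (abs_sub_le _ _ _).trans ((add_le_add h1 h2).trans ?_)
        push_cast
        rw [← hβ]
        linarith
    · rw [Finset.sum_add_distrib, Finset.sum_const, hreg, nsmul_eq_mul, Finset.sum_add_distrib,
        Finset.sum_add_distrib, Finset.sum_add_distrib]
      have hd0 : 0 ≤ (d : ℝ)⁻¹ := by positivity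
      have s1 := sum_indicator_le (G.neighborFinset (σ v)) (· ∈ F) hd0 (m := #F)
        (Finset.card_le_card fun w hw => (Finset.mem_filter.1 hw).2)
      have s2 := sum_indicator_le (G.neighborFinset (σ v)) (σ · = y) hd0
        (card_filter_apply_eq_le_one _ σ y)
      have s3 := sum_indicator_le (G.neighborFinset (σ v)) (· = y) hd0
        (card_filter_apply_eq_le_one _ 1 y)
      set q : ℝ := if σ v = y then (d : ℝ)⁻¹ else 0
      rw [inv_mul_le_iff₀ hd']
      refine (add_le_add_right (add_le_add (add_le_add s1 s2) (add_le_add s3 s2)) _).trans ?_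
      have e1 : d * (((↑(t + 1) : ℝ) * (4 * (↑(t + 1) : ℝ) + 3 + #F)) / d ^ 2 + q)
          - (d * (α + β + q) + (#F * (d : ℝ)⁻¹ + (1 : ℕ) * (d : ℝ)⁻¹
            + ((1 : ℕ) * (d : ℝ)⁻¹ + (1 : ℕ) * (d : ℝ)⁻¹))) = (4 * t + 4) * (d : ℝ)⁻¹ := by
        rw [hα, hβ]
        push_cast
        field_simp
        ring
      have e2 : 0 ≤ (4 * t + 4) * (d : ℝ)⁻¹ := by positivity
      linarith

/-- The rotation chain is mixing whenever all the walks given by the permutations are. -/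
theorem abs_rotProb_sub_uniform_le {d : ℕ} (hd : 0 < d)
    (hreg : ∀ x, (G.neighborFinset x).card = d) (hF : ∀ x ∈ F, ρ x ∈ F) (hv : v ∉ F)
    (hy : y ∉ F) (hyv : y ≠ v) {t : ℕ} {u ξ : ℝ} (hu0 : 0 ≤ u) (hu : u ≤ (d : ℝ)⁻¹)
    (hmix : ∀ (σ : Equiv.Perm V) (x y : V), |(walk G d σ ^ (t + 1)) x y - u| ≤ ξ)
    (hσ : IsNear G v ρ F σ) :
    |rotProb G d v F y (t + 2) σ - u|
      ≤ ξ + (t * (4 * t + 3 + #F) + #F + 1 : ℝ) / d ^ 2 := by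
  have hd' : (0 : ℝ) < d := by exact_mod_cast hd
  have hd0 : 0 ≤ (d : ℝ)⁻¹ := by positivity
  set α : ℝ := (t * (4 * t + 3 + #F) : ℝ) / d ^ 2 with hα
  have hα0 : 0 ≤ α := by positivity
  have hξ : 0 ≤ ξ := (abs_nonneg _).trans (hmix 1 y y)
  have key := abs_rotStep_sub_le (σ := σ) (v := v) (F := F) (G := G) hd
    (rotProb G d v F y (t + 1)) (fun _ => u)
    (fun w => (ξ + α) + ((if w ∈ F then (d : ℝ)⁻¹ else 0) + (if σ w = y then (d : ℝ)⁻¹ else 0)))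
    (fun w hw => by
      rw [SimpleGraph.mem_neighborFinset] at hw
      have i0 : 0 ≤ (if σ w = y then (d : ℝ)⁻¹ else 0) := by split_ifs <;> positivity
      by_cases hwF : w ∈ F
      · simp only [hwF, not_true, if_false, if_true, zero_sub, abs_neg]
        rw [abs_of_nonneg hu0]
        linarith
      · simp only [hwF, not_false_eq_true, if_true, if_false]
        have h1 := abs_rotProb_sub_walk_le hd hreg hF hv hy hyv t (hσ.rot hF hv hw hwF)
        rw [hσ.rot_apply_left hw.ne'] at h1
        refine (abs_sub_le _ _ _).trans ((add_le_add h1 (hmix _ _ _)).trans ?_)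
        rw [← hα]
        linarith)
  rw [Finset.sum_const, hreg, nsmul_eq_mul, inv_mul_cancel_left₀ hd'.ne', ← rotProb_succ] at key
  refine key.trans ?_
  rw [Finset.sum_add_distrib, Finset.sum_const, hreg, nsmul_eq_mul, Finset.sum_add_distrib]
  have s1 := sum_indicator_le (G.neighborFinset (σ v)) (· ∈ F) hd0 (m := #F)
    (Finset.card_le_card fun w hw => (Finset.mem_filter.1 hw).2)
  have s2 := sum_indicator_le (G.neighborFinset (σ v)) (σ · = y) hd0
    (card_filter_apply_eq_le_one _ σ y)
  rw [inv_mul_le_iff₀ hd']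
  refine (add_le_add_right (add_le_add s1 s2) _).trans (le_of_eq ?_)
  rw [hα]
  push_cast
  field_simp
  ring

theorem sum_rotProb {d : ℕ} (hF : ∀ x ∈ F, ρ x ∈ F) (hv : v ∉ F) (y : V) (t : ℕ) :
    ∑ σ ∈ nearSet G v ρ F, rotProb G d v F y t σ
      = ∑ σ ∈ nearSet G v ρ F with σ v = y, (rotStep G d v F)^[t] (fun _ => 1) σ := by
  have := rotStep_iterate_symm (G := G) d hF hv (fun _ => 1) (fun σ => if σ v = y then 1 else 0) t
  simp only [one_mul, mul_ite, mul_one, mul_zero] at this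
  rw [Finset.sum_filter, ← this]
  rfl

/-- All positions of the defect are almost equally likely. -/
theorem card_nearSet_filter_bounds {d : ℕ} (hd : 0 < d)
    (hreg : ∀ x, (G.neighborFinset x).card = d) (hF : ∀ x ∈ F, ρ x ∈ F) (hv : v ∉ F)
    (hFd : #F ≤ d) {t : ℕ} {u ξ : ℝ} (h : ∀ σ ∈ nearSet G v ρ F, |rotProb G d v F y t σ - u| ≤ ξ) :
    (u - ξ) * #(nearSet G v ρ F) ≤ #{σ ∈ nearSet G v ρ F | σ v = y} ∧
      (1 - (#F : ℝ) / d) ^ t * #{σ ∈ nearSet G v ρ F | σ v = y}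
        ≤ (u + ξ) * #(nearSet G v ρ F) := by
  have hs := sum_rotProb (G := G) (d := d) hF hv y t
  have h1 : (u - ξ) * #(nearSet G v ρ F) ≤ ∑ σ ∈ nearSet G v ρ F, rotProb G d v F y t σ := by
    rw [mul_comm, ← nsmul_eq_mul]
    exact Finset.card_nsmul_le_sum _ _ _ fun σ hσ => by linarith [(abs_le.1 (h σ hσ)).1]
  have h2 : ∑ σ ∈ nearSet G v ρ F, rotProb G d v F y t σ ≤ (u + ξ) * #(nearSet G v ρ F) := by
    rw [mul_comm, ← nsmul_eq_mul]
    exact Finset.sum_le_card_nsmul _ _ _ fun σ hσ => by linarith [(abs_le.1 (h σ hσ)).2]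
  have h3 : ∑ σ ∈ nearSet G v ρ F with σ v = y, (rotStep G d v F)^[t] (fun _ => 1) σ
      ≤ #{σ ∈ nearSet G v ρ F | σ v = y} := by
    have := Finset.sum_le_card_nsmul {σ ∈ nearSet G v ρ F | σ v = y}
      ((rotStep G d v F)^[t] (fun _ => 1)) 1 fun σ _ => rotStep_iterate_one_le hd hreg t σ
    simpa using this
  have h4 : (1 - (#F : ℝ) / d) ^ t * #{σ ∈ nearSet G v ρ F | σ v = y}
      ≤ ∑ σ ∈ nearSet G v ρ F with σ v = y, (rotStep G d v F)^[t] (fun _ => 1) σ := by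
    rw [mul_comm, ← nsmul_eq_mul]
    exact Finset.card_nsmul_le_sum _ _ _ fun σ _ => le_rotStep_iterate_one hd hreg hFd t σ
  exact ⟨by linarith, by linarith⟩

end Tracking
section Extension

variable {V : Type*} [Fintype V] [DecidableEq V] {G : SimpleGraph V} [DecidableRel G.Adj]
  {v y : V} {ρ : Equiv.Perm V} {F : Finset V} {σ : Equiv.Perm V}

/-- The perfect matchings of `G`, encoded as permutations. -/
def pmSet (G : SimpleGraph V) [DecidableRel G.Adj] : Finset (Equiv.Perm V) :=
  {σ | (∀ x, σ (σ x) = x) ∧ ∀ x, G.Adj x (σ x)}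

theorem mem_pmSet : σ ∈ pmSet G ↔ (∀ x, σ (σ x) = x) ∧ ∀ x, G.Adj x (σ x) := by
  simp [pmSet]

/-- The perfect matchings of `G` which agree with `ρ` on `S`. -/
def agreeSet (G : SimpleGraph V) [DecidableRel G.Adj] (ρ : Equiv.Perm V) (S : Finset V) :
    Finset (Equiv.Perm V) :=
  {σ ∈ pmSet G | ∀ x ∈ S, σ x = ρ x}

theorem mem_agreeSet {S : Finset V} :
    σ ∈ agreeSet G ρ S ↔ σ ∈ pmSet G ∧ ∀ x ∈ S, σ x = ρ x := by
  simp [agreeSet]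

theorem nearSet_filter_eq (hvy : G.Adj v y) :
    ({σ ∈ nearSet G v ρ F | σ v = y} : Finset _) = {σ ∈ agreeSet G ρ F | σ v = y} := by
  ext σ
  simp only [Finset.mem_filter, mem_nearSet, mem_agreeSet, mem_pmSet]
  refine ⟨fun ⟨h, hy⟩ => ⟨⟨⟨h.invol, fun x => ?_⟩, h.eq_on⟩, hy⟩,
    fun ⟨⟨⟨h1, h2⟩, h3⟩, hy⟩ => ⟨⟨h1, fun x => (h2 x).ne', fun x _ _ => h2 x, h3⟩, hy⟩⟩
  by_cases h1 : x = v
  · rw [h1, hy]; exact hvy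
  by_cases h2 : x = σ v
  · rw [h2, h.invol, hy]; exact hvy.symm
  exact h.adj x h1 h2

theorem card_agreeSet_eq_sum (hF : ∀ x ∈ F, ρ x ∈ F) (hv : v ∉ F) :
    #(agreeSet G ρ F)
      = ∑ y ∈ G.neighborFinset v with y ∉ F, #{σ ∈ nearSet G v ρ F | σ v = y} := by
  rw [Finset.card_eq_sum_card_fiberwise (f := fun σ : Equiv.Perm V => σ v)
    (t := {y ∈ G.neighborFinset v | y ∉ F})]
  · refine Finset.sum_congr rfl fun y hy => ?_
    rw [nearSet_filter_eq]
    simpa using (Finset.mem_filter.1 hy).1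
  · intro σ hσ
    have hσ' := mem_agreeSet.1 (Finset.mem_coe.1 hσ)
    obtain ⟨h1, h2⟩ := mem_pmSet.1 hσ'.1
    simp only [Finset.coe_filter, SimpleGraph.mem_neighborFinset, Set.mem_ofPred_eq]
    refine ⟨h2 v, fun h => hv ?_⟩
    have h3 := hσ'.2 _ h
    rw [h1] at h3
    exact h3 ▸ hF _ h

theorem agreeSet_bounds {d : ℕ} {η q : ℝ} (hη0 : 0 < η) (hη : 16 * η ≤ 1) (hq : 0 ≤ q)
    (hreg : ∀ x, (G.neighborFinset x).card = d)
    (hF : ∀ x ∈ F, ρ x ∈ F) (hv : v ∉ F) (hFd : (#F : ℝ) ≤ η * d) (hρ : ρ ∈ pmSet G)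
    (h : ∀ y, y ∉ F → y ≠ v → (1 - η) * q ≤ #{σ ∈ nearSet G v ρ F | σ v = y} ∧
      (1 - η) * #{σ ∈ nearSet G v ρ F | σ v = y} ≤ (1 + η) * q) :
    |d * (#{σ ∈ agreeSet G ρ F | σ v = ρ v} : ℝ) - #(agreeSet G ρ F)|
      ≤ 16 * η * #(agreeSet G ρ F) := by
  obtain ⟨hρ1, hρ2⟩ := mem_pmSet.1 hρ
  have hρv : ρ v ∉ F := fun h' => hv (hρ1 v ▸ hF _ h')
  have h0 := h (ρ v) hρv (hρ2 v).ne'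
  rw [nearSet_filter_eq (hρ2 v)] at h0
  set a' : ℝ := (#{σ ∈ agreeSet G ρ F | σ v = ρ v} : ℝ)
  set a : ℝ := (#(agreeSet G ρ F) : ℝ) with ha
  set N : Finset V := {y ∈ G.neighborFinset v | y ∉ F} with hN
  have hsum : a = ∑ y ∈ N, (#{σ ∈ nearSet G v ρ F | σ v = y} : ℝ) := by
    rw [ha, card_agreeSet_eq_sum hF hv]
    push_cast
    rfl
  have hyN : ∀ y ∈ N, y ∉ F ∧ y ≠ v := by
    intro y hy
    simp only [hN, Finset.mem_filter, SimpleGraph.mem_neighborFinset] at hy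
    exact ⟨hy.2, hy.1.ne'⟩
  have hNd : (#N : ℝ) ≤ d := by
    rw [← hreg v]; exact_mod_cast Finset.card_filter_le _ _
  have hNd' : (1 - η) * d ≤ #N := by
    have := card_neighborFinset_filter_ge (F := F) hreg v
    linarith
  have hη1 : 0 < 1 - η := by linarith
  have hlow : (1 - η) * d * ((1 - η) * q) ≤ a := by
    have : #N * ((1 - η) * q) ≤ a := by
      rw [hsum, ← nsmul_eq_mul]
      exact Finset.card_nsmul_le_sum _ _ _ fun y hy => (h y (hyN y hy).1 (hyN y hy).2).1
    refine le_trans ?_ this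
    gcongr
  have hupp : (1 - η) * a ≤ d * ((1 + η) * q) := by
    have : (1 - η) * a ≤ #N * ((1 + η) * q) := by
      rw [hsum, Finset.mul_sum, ← nsmul_eq_mul]
      exact Finset.sum_le_card_nsmul _ _ _ fun y hy => (h y (hyN y hy).1 (hyN y hy).2).2
    refine this.trans ?_
    gcongr
  have ha0 : 0 ≤ a := by positivity
  have hd0 : (0 : ℝ) ≤ d := by positivity
  have hu : (1 - η) ^ 3 * (d * a') ≤ (1 + η) * a := by
    calc (1 - η) ^ 3 * (d * a') = (1 - η) ^ 2 * d * ((1 - η) * a') := by ring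
      _ ≤ (1 - η) ^ 2 * d * ((1 + η) * q) := mul_le_mul_of_nonneg_left h0.2 (by positivity)
      _ = (1 + η) * ((1 - η) * d * ((1 - η) * q)) := by ring
      _ ≤ (1 + η) * a := by gcongr
  have hl : (1 - η) ^ 2 * a ≤ (1 + η) * (d * a') := by
    calc (1 - η) ^ 2 * a = (1 - η) * ((1 - η) * a) := by ring
      _ ≤ (1 - η) * (d * ((1 + η) * q)) := by gcongr
      _ = (1 + η) * (d * ((1 - η) * q)) := by ring
      _ ≤ (1 + η) * (d * a') := by gcongr; exact h0.1
  have e1 : 1 + η ≤ (1 + 16 * η) * (1 - η) ^ 3 := by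
    have h3 : 1 - 3 * η ≤ (1 - η) ^ 3 := by
      have := mul_nonneg (sq_nonneg η) (by linarith : 0 ≤ 3 - η)
      linarith [show (1 - η) ^ 3 = 1 - 3 * η + η ^ 2 * (3 - η) by ring]
    calc 1 + η ≤ (1 + 16 * η) * (1 - 3 * η) := by nlinarith
      _ ≤ _ := by gcongr
  have e2 : (1 - 16 * η) * (1 + η) ≤ (1 - η) ^ 2 := by nlinarith [mul_pos hη0 hη0]
  have u1 : d * a' ≤ (1 + 16 * η) * a := by
    have hp : 0 < (1 - η) ^ 3 := by positivity
    refine le_of_mul_le_mul_left (hu.trans ?_) hp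
    calc (1 + η) * a ≤ (1 + 16 * η) * (1 - η) ^ 3 * a := by gcongr
      _ = _ := by ring
  have l1 : (1 - 16 * η) * a ≤ d * a' := by
    have hp : 0 < 1 + η := by positivity
    refine le_of_mul_le_mul_left (le_trans ?_ hl) hp
    calc (1 + η) * ((1 - 16 * η) * a) = (1 - 16 * η) * (1 + η) * a := by ring
      _ ≤ _ := by gcongr
  rw [abs_le]
  constructor <;> linarith

end Extension

/-- Among the perfect matchings agreeing with `ρ` on a small set `F`, a proportion of about
`1 / d` contains any further given edge of `ρ`. -/
theorem exists_agreeSet_extension {δ ν ξ : ℝ} (hδ : 0 < δ) (hν : 0 < ν) (hξ : 0 < ξ)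
    (hξ1 : ξ ≤ 1) (K : ℕ) :
    ∃ n₀ : ℕ, ∀ (V : Type) [Fintype V] [DecidableEq V] (G : SimpleGraph V)
      [DecidableRel G.Adj] (d : ℕ), n₀ ≤ Fintype.card V →
      (∀ x, (G.neighborFinset x).card = d) →
      δ * Fintype.card V ≤ d → RobustExpander G ν (δ / 2) → ∀ ρ ∈ pmSet G,
      ∀ F : Finset V, (∀ x ∈ F, ρ x ∈ F) → #F ≤ K → ∀ v, v ∉ F →
      |d * (#{σ ∈ agreeSet G ρ F | σ v = ρ v} : ℝ) - #(agreeSet G ρ F)|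
        ≤ ξ * #(agreeSet G ρ F) := by
  set η := ξ / 16 with hη
  have hη0 : 0 < η := by positivity
  obtain ⟨L, hL, hmix⟩ := exists_walk_mixing hδ hν (half_pos hη0)
  obtain ⟨t, rfl⟩ : ∃ t, L = t + 1 := ⟨L - 1, by omega⟩
  set A : ℝ := t * (4 * t + 3 + K) + K + 1 with hA
  have hA0 : 0 < A := by positivity
  obtain ⟨n₁, hn₁⟩ := exists_nat_ge (A / (δ ^ 2 * (η / 2)))
  obtain ⟨n₂, hn₂⟩ := exists_nat_ge ((t + 2) * K / (δ * η))
  refine ⟨max 1 (max n₁ n₂), ?_⟩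
  intro V _ _ G _ d hn hreg hδd hexp ρ hρ F hF hFK v hv
  simp only [max_le_iff] at hn
  obtain ⟨hn0, hn1, hn2⟩ := hn
  set n : ℝ := (Fintype.card V : ℝ) with hn_def
  have hnpos : 0 < n := by rw [hn_def]; exact_mod_cast hn0
  have hn1' : A / (δ ^ 2 * (η / 2)) ≤ n := hn₁.trans (by rw [hn_def]; exact_mod_cast hn1)
  have hn2' : (t + 2) * K / (δ * η) ≤ n := hn₂.trans (by rw [hn_def]; exact_mod_cast hn2)
  rw [div_le_iff₀ (by positivity)] at hn1' hn2'
  have hd' : (0 : ℝ) < d := lt_of_lt_of_le (by positivity) hδd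
  have hd : 0 < d := by exact_mod_cast hd'
  have hdn : (d : ℝ) ≤ n := by
    rw [hn_def, ← hreg v]; exact_mod_cast Finset.card_le_univ _
  have hFK' : (#F : ℝ) ≤ K := by exact_mod_cast hFK
  have hFT : (t + 2) * (#F : ℝ) ≤ η * d := by
    calc (t + 2) * (#F : ℝ) ≤ (t + 2) * K := by gcongr
      _ ≤ n * (δ * η) := hn2'
      _ = η * (δ * n) := by ring
      _ ≤ η * d := by gcongr
  have hFd : (#F : ℝ) ≤ η * d := by
    have : (0 : ℝ) ≤ (t + 1) * #F := by positivity
    linarith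
  have hη1 : η ≤ 1 / 16 := by rw [hη]; linarith
  have hFd1 : #F ≤ d := by
    have : η * d ≤ 1 * d := by gcongr; linarith
    have : (#F : ℝ) ≤ d := by linarith
    exact_mod_cast this
  have hdsq : A / (d : ℝ) ^ 2 ≤ η / 2 / n := by
    rw [div_le_div_iff₀ (by positivity) hnpos]
    calc A * n ≤ n * (δ ^ 2 * (η / 2)) * n := by gcongr
      _ = η / 2 * (δ * n) ^ 2 := by ring
      _ ≤ η / 2 * (d : ℝ) ^ 2 := by gcongr
  set q : ℝ := #(nearSet G v ρ F) / n with hq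
  have hq0 : 0 ≤ q := by positivity
  rw [show ξ = 16 * η by rw [hη]; ring]
  refine agreeSet_bounds hη0 (by linarith) hq0 hreg hF hv hFd hρ fun y hy hyv => ?_
  have hb := card_nearSet_filter_bounds (G := G) (y := y) (t := t + 2) (u := 1 / n) (ξ := η / n)
    hd hreg hF hv hFd1 fun σ hσ => by
      refine (abs_rotProb_sub_uniform_le hd hreg hF hv hy hyv (by positivity) ?_
        (fun σ x y => hmix V G d hd hreg hδd hexp σ x y) (mem_nearSet.1 hσ)).trans ?_
      · rw [one_div]; gcongr
      · have : (t * (4 * t + 3 + #F) + #F + 1 : ℝ) / d ^ 2 ≤ A / d ^ 2 := by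
          rw [hA]; gcongr
        have e : η / n = η / 2 / n + η / 2 / n := by ring
        rw [e]
        exact add_le_add le_rfl (this.trans hdsq)
  have e1 : (1 / n - η / n) * #(nearSet G v ρ F) = (1 - η) * q := by rw [hq]; ring
  have e2 : (1 / n + η / n) * #(nearSet G v ρ F) = (1 + η) * q := by rw [hq]; ring
  rw [e1, e2] at hb
  refine ⟨hb.1, le_trans ?_ hb.2⟩
  gcongr
  have hFle : (#F : ℝ) / d ≤ 1 := by
    rw [div_le_one hd']; exact_mod_cast hFd1
  have hbern := one_add_mul_le_pow (a := -((#F : ℝ) / d)) (by linarith) (t + 2)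
  rw [← sub_eq_add_neg] at hbern
  refine le_trans ?_ hbern
  have : ((t : ℝ) + 2) * ((#F : ℝ) / d) ≤ η := by
    rw [← mul_div_assoc, div_le_iff₀ hd']; exact hFT
  push_cast
  linarith

section Product

variable {V : Type*} [Fintype V] [DecidableEq V] {G : SimpleGraph V} [DecidableRel G.Adj]
  {ρ : Equiv.Perm V}

theorem agreeSet_empty : agreeSet G ρ ∅ = pmSet G := by
  simp [agreeSet]

theorem agreeSet_insert (S : Finset V) (v : V) :
    agreeSet G ρ (insert v S) = {σ ∈ agreeSet G ρ S | σ v = ρ v} := by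
  ext σ
  simp only [mem_agreeSet, Finset.mem_filter, Finset.forall_mem_insert]
  tauto

theorem agreeSet_union_image (hρ : ∀ x, ρ (ρ x) = x) (S : Finset V) :
    agreeSet G ρ (S ∪ S.image ρ) = agreeSet G ρ S := by
  ext σ
  simp only [mem_agreeSet, Finset.mem_union, Finset.mem_image]
  refine ⟨fun ⟨h1, h2⟩ => ⟨h1, fun x hx => h2 x (Or.inl hx)⟩, fun ⟨h1, h2⟩ => ⟨h1, ?_⟩⟩
  rintro x (hx | ⟨y, hy, rfl⟩)
  · exact h2 x hx
  · rw [← h2 y hy, (mem_pmSet.1 h1).1, h2 y hy, hρ]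

theorem abs_pow_mul_card_agreeSet_sub_le {ξ : ℝ} {d K : ℕ} {T : Finset V} (hξ : 0 ≤ ξ)
    (hρ : ρ ∈ pmSet G) (hT : ∀ x ∈ T, ρ x ∉ T)
    (hext : ∀ F : Finset V, (∀ x ∈ F, ρ x ∈ F) → #F ≤ 2 * K → ∀ v, v ∉ F →
      |d * (#{σ ∈ agreeSet G ρ F | σ v = ρ v} : ℝ) - #(agreeSet G ρ F)|
        ≤ ξ * #(agreeSet G ρ F))
    (S : Finset V) (hST : S ⊆ T) (hSK : #S ≤ K) :
    |(d : ℝ) ^ #S * #(agreeSet G ρ S) - #(pmSet G)| ≤ ((1 + ξ) ^ #S - 1) * #(pmSet G) := by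
  have hρ1 := (mem_pmSet.1 hρ).1
  induction S using Finset.induction_on with
  | empty => simp [agreeSet_empty]
  | insert v S hv ih =>
    rw [Finset.card_insert_of_notMem hv] at hSK ⊢
    obtain ⟨hvT, hsub⟩ := Finset.insert_subset_iff.1 hST
    have ih := ih hsub (by omega)
    have hmem : ∀ x ∈ S ∪ S.image ρ, ρ x ∈ S ∪ S.image ρ := by
      intro x hx
      rcases Finset.mem_union.1 hx with hx | hx
      · exact Finset.mem_union_right _ (Finset.mem_image_of_mem _ hx)
      · obtain ⟨y, hy, rfl⟩ := Finset.mem_image.1 hx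
        rw [hρ1]; exact Finset.mem_union_left _ hy
    have hcard : #(S ∪ S.image ρ) ≤ 2 * K := by
      have h1 := Finset.card_union_le S (S.image ρ)
      have h2 : #(S.image ρ) ≤ #S := Finset.card_image_le
      omega
    have hvF : v ∉ S ∪ S.image ρ := by
      simp only [Finset.mem_union, Finset.mem_image, not_or]
      refine ⟨hv, ?_⟩
      rintro ⟨y, hy, rfl⟩
      exact hT y (hsub hy) hvT
    have h := hext _ hmem hcard v hvF
    rw [agreeSet_union_image hρ1, ← agreeSet_insert] at h
    set a : ℝ := (#(agreeSet G ρ S) : ℝ)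
    set b : ℝ := (#(agreeSet G ρ (insert v S)) : ℝ)
    set M : ℝ := (#(pmSet G) : ℝ)
    set D : ℝ := (d : ℝ) ^ #S
    have hD : 0 ≤ D := by positivity
    have hDa : D * a ≤ (1 + ξ) ^ #S * M := by
      have := (abs_le.1 ih).2
      linarith
    calc |(d : ℝ) ^ (#S + 1) * b - M| = |D * (d * b - a) + (D * a - M)| := by
          congr 1; simp only [D]; ring
      _ ≤ |D * (d * b - a)| + |D * a - M| := abs_add_le _ _
      _ ≤ D * (ξ * a) + ((1 + ξ) ^ #S - 1) * M := by
          rw [abs_mul, abs_of_nonneg hD]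
          exact add_le_add (mul_le_mul_of_nonneg_left h hD) ih
      _ = ξ * (D * a) + ((1 + ξ) ^ #S - 1) * M := by ring
      _ ≤ ξ * ((1 + ξ) ^ #S * M) + ((1 + ξ) ^ #S - 1) * M := by gcongr
      _ = _ := by ring

/-- A fixed-point-free involution has a transversal of its orbits. -/
theorem exists_transversal (h1 : ∀ x, ρ (ρ x) = x) (h2 : ∀ x, ρ x ≠ x) :
    ∃ T : Finset V, (∀ x, x ∈ T ↔ ρ x ∉ T) ∧ 2 * #T = Fintype.card V := by
  let e := Fintype.equivFin V
  have hT : ∀ x, x ∈ ({x | e x < e (ρ x)} : Finset V) ↔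
      ρ x ∉ ({x | e x < e (ρ x)} : Finset V) := by
    intro x
    have : e x ≠ e (ρ x) := fun h => h2 x (e.injective h).symm
    simp only [Finset.mem_filter_univ, h1, not_lt]
    exact ⟨le_of_lt, fun h => lt_of_le_of_ne h this⟩
  refine ⟨_, hT, ?_⟩
  set T : Finset V := {x | e x < e (ρ x)}
  have hc : T.map ρ.toEmbedding = Tᶜ := by
    ext x
    rw [Finset.mem_map_equiv, Finset.mem_compl, ← not_iff_not, not_not]
    have : ρ.symm x = ρ x := by rw [Equiv.symm_apply_eq, h1]
    rw [this]
    exact (hT x).symm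
  have := Finset.card_add_card_compl T
  rw [← hc, Finset.card_map] at this
  omega

theorem sum_choose_card_eq_sum_agreeSet (T : Finset V) (i : ℕ) :
    ∑ σ ∈ pmSet G, (#{t ∈ T | σ t = ρ t}).choose i
      = ∑ S ∈ T.powersetCard i, #(agreeSet G ρ S) := by
  have h : ∀ σ : Equiv.Perm V, (#{t ∈ T | σ t = ρ t}).choose i
      = ∑ S ∈ T.powersetCard i, if ∀ x ∈ S, σ x = ρ x then 1 else 0 := by
    intro σ
    rw [← Finset.card_powersetCard, ← Finset.card_filter]
    congr 1
    ext S
    simp only [Finset.mem_powersetCard, Finset.mem_filter, Finset.subset_iff]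
    grind
  simp_rw [h]
  rw [Finset.sum_comm]
  refine Finset.sum_congr rfl fun S _ => ?_
  rw [agreeSet, Finset.card_filter]

end Product

/-- Truncated inclusion-exclusion (Bonferroni) for a single count. -/
theorem abs_ite_sub_sum_choose_le (n K : ℕ) :
    |(if n = 0 then 1 else 0 : ℝ) - ∑ i ∈ range K, (-1) ^ i * (n.choose i : ℝ)|
      ≤ n.choose K := by
  rcases K with _ | m
  · rcases n with _ | n <;> simp
  rcases n with _ | n
  · simp [Finset.sum_range_succ']
  · have h := congrArg (Int.cast : ℤ → ℝ) (Int.alternating_sum_range_choose_eq_choose (n := n)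
      (m := m))
    push_cast at h
    rw [h, if_neg n.succ_ne_zero, zero_sub, abs_neg, abs_mul, abs_pow, abs_neg, abs_one, one_pow,
      one_mul, Nat.abs_cast]
    rw [Nat.choose_succ_succ]
    exact_mod_cast Nat.le_add_right _ _

theorem abs_choose_div_pow_sub_le {m d : ℕ} (hd : 0 < d) {i : ℕ} (him : i ≤ m) (hm : 0 < m) :
    |(m.choose i : ℝ) / d ^ i - (m / d : ℝ) ^ i / i.factorial|
      ≤ (i : ℝ) ^ 2 / m * ((m / d : ℝ) ^ i / i.factorial) := by
  have hd' : (0 : ℝ) < d := by exact_mod_cast hd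
  have hm' : (0 : ℝ) < m := by exact_mod_cast hm
  have hi' : (0 : ℝ) < i.factorial := by exact_mod_cast i.factorial_pos
  have hch : (m.choose i : ℝ) / d ^ i
      = (m.descFactorial i / m ^ i : ℝ) * ((m / d : ℝ) ^ i / i.factorial) := by
    rw [Nat.descFactorial_eq_factorial_mul_choose, div_pow]
    push_cast
    field_simp
  set c : ℝ := (m / d : ℝ) ^ i / i.factorial
  have hc : 0 ≤ c := by positivity
  have h1 : (m.descFactorial i / m ^ i : ℝ) ≤ 1 := by
    rw [div_le_one (by positivity)]
    exact_mod_cast Nat.descFactorial_le_pow m i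
  have h2 : 1 - (i : ℝ) ^ 2 / m ≤ (m.descFactorial i / m ^ i : ℝ) := by
    have hle : ((m : ℝ) - i) ^ i ≤ m.descFactorial i := by
      have h3 : ((m - i : ℕ) : ℝ) ^ i ≤ m.descFactorial i := by
        exact_mod_cast (Nat.pow_le_pow_left (by omega) i).trans (Nat.pow_sub_le_descFactorial m i)
      rwa [Nat.cast_sub him] at h3
    have hfr : (i : ℝ) / m ≤ 1 := by rw [div_le_one hm']; exact_mod_cast him
    have hbern := one_add_mul_le_pow (a := -((i : ℝ) / m)) (by linarith) i
    calc 1 - (i : ℝ) ^ 2 / m = 1 + i * -((i : ℝ) / m) := by ring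
      _ ≤ (1 + -((i : ℝ) / m)) ^ i := hbern
      _ = ((m : ℝ) - i) ^ i / m ^ i := by rw [← div_pow]; congr 1; field_simp; ring
      _ ≤ _ := by gcongr
  rw [hch, abs_le]
  constructor
  · nlinarith
  · nlinarith [show 0 ≤ (i : ℝ) ^ 2 / m by positivity]

/-- The alternating sum of factorial moments close to those of a Poisson variable
approximates the probability that the Poisson variable vanishes. -/
theorem abs_sub_exp_neg_le {K : ℕ} {l L θ p : ℝ} {c : ℕ → ℝ} (hl : 0 ≤ l) (hlL : l ≤ L)
    (hθ1 : θ ≤ 1) (hK : L / (K + 1) ≤ 1 / 2)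
    (hc : ∀ i ≤ K, |c i - l ^ i / i.factorial| ≤ θ * (l ^ i / i.factorial))
    (hp : |p - ∑ i ∈ range K, (-1) ^ i * c i| ≤ c K) :
    |p - Real.exp (-l)| ≤ θ * Real.exp L + 4 * (L ^ K / K.factorial) := by
  have hθ0 : 0 ≤ θ := by simpa using (abs_nonneg _).trans (hc 0 (Nat.zero_le _))
  have hexp : |Real.exp (-l) - ∑ i ∈ range K, (-l) ^ i / i.factorial|
      ≤ l ^ K / K.factorial * 2 := by
    have h := Complex.exp_bound' (x := ((-l : ℝ) : ℂ)) (n := K) (by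
      rw [Complex.norm_real, Real.norm_eq_abs, abs_neg, abs_of_nonneg hl, Nat.succ_eq_add_one]
      refine le_trans ?_ hK
      push_cast
      gcongr)
    rw [Complex.norm_real, Real.norm_eq_abs, abs_neg, abs_of_nonneg hl] at h
    rw [← Real.norm_eq_abs, ← Complex.norm_real]
    push_cast at h ⊢
    exact h
  have hmid : |∑ i ∈ range K, (-1) ^ i * c i - ∑ i ∈ range K, (-l) ^ i / i.factorial|
      ≤ θ * Real.exp l := by
    rw [← Finset.sum_sub_distrib]
    calc _ ≤ ∑ i ∈ range K, |(-1) ^ i * c i - (-l) ^ i / i.factorial| :=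
          Finset.abs_sum_le_sum_abs _ _
      _ ≤ ∑ i ∈ range K, θ * (l ^ i / i.factorial) := by
          refine Finset.sum_le_sum fun i hi => ?_
          rw [neg_pow l, mul_div_assoc, ← mul_sub, abs_mul, abs_pow, abs_neg, abs_one, one_pow,
            one_mul]
          exact hc i (Finset.mem_range.1 hi).le
      _ ≤ _ := by
          rw [← Finset.mul_sum]
          exact mul_le_mul_of_nonneg_left (Real.sum_le_exp_of_nonneg hl _) hθ0
  have hcK : c K ≤ 2 * (l ^ K / K.factorial) := by
    have := (abs_le.1 (hc K le_rfl)).2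
    have h0 : 0 ≤ l ^ K / K.factorial := by positivity
    nlinarith
  have hpow : l ^ K / K.factorial ≤ L ^ K / K.factorial := by gcongr
  have hE : θ * Real.exp l ≤ θ * Real.exp L := by gcongr
  rw [abs_le] at *
  constructor <;> linarith [hp.1, hp.2, hmid.1, hmid.2, hexp.1, hexp.2]

section Count

variable {V : Type*} [Fintype V] [DecidableEq V] {G : SimpleGraph V} [DecidableRel G.Adj]
  {ρ σ : Equiv.Perm V}

theorem abs_card_avoid_div_sub_exp_le {ξ L : ℝ} {d K : ℕ} {T : Finset V} (hd : 0 < d)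
    (hξ : 0 ≤ ξ) (hρ : ρ ∈ pmSet G) (hT : ∀ x ∈ T, ρ x ∉ T) (hT0 : 0 < #T) (hKT : K ≤ #T)
    (hL : (#T / d : ℝ) ≤ L) (hK : L / (K + 1) ≤ 1 / 2)
    (hθ : (1 + ξ) ^ K - 1 + (K : ℝ) ^ 2 / #T ≤ 1)
    (hext : ∀ F : Finset V, (∀ x ∈ F, ρ x ∈ F) → #F ≤ 2 * K → ∀ v, v ∉ F →
      |d * (#{σ ∈ agreeSet G ρ F | σ v = ρ v} : ℝ) - #(agreeSet G ρ F)|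
        ≤ ξ * #(agreeSet G ρ F)) :
    |(#{σ ∈ pmSet G | ∀ t ∈ T, σ t ≠ ρ t} : ℝ) / #(pmSet G) - Real.exp (-(#T / d : ℝ))|
      ≤ ((1 + ξ) ^ K - 1 + (K : ℝ) ^ 2 / #T) * Real.exp L + 4 * (L ^ K / K.factorial) := by
  have hd' : (0 : ℝ) < d := by exact_mod_cast hd
  have hT0' : (0 : ℝ) < #T := by exact_mod_cast hT0
  have hM : (0 : ℝ) < #(pmSet G) := by exact_mod_cast Finset.card_pos.2 ⟨ρ, hρ⟩
  set M : ℝ := (#(pmSet G) : ℝ) with hM_def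
  let b : ℕ → ℝ := fun i => ∑ S ∈ T.powersetCard i, (#(agreeSet G ρ S) : ℝ)
  refine abs_sub_exp_neg_le (c := fun i => b i / M) (by positivity) hL hθ hK ?_ ?_
  · intro i hi
    have h1 : |(d : ℝ) ^ i * b i - (#T).choose i * M|
        ≤ (#T).choose i * (((1 + ξ) ^ i - 1) * M) := by
      rw [← Finset.card_powersetCard, ← nsmul_eq_mul, ← nsmul_eq_mul, ← Finset.sum_const,
        ← Finset.sum_const, Finset.mul_sum, ← Finset.sum_sub_distrib]
      refine (Finset.abs_sum_le_sum_abs _ _).trans (Finset.sum_le_sum fun S hS => ?_)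
      obtain ⟨hST, rfl⟩ := Finset.mem_powersetCard.1 hS
      exact abs_pow_mul_card_agreeSet_sub_le hξ hρ hT hext S hST hi
    have h2 : |b i / M - (#T).choose i / (d : ℝ) ^ i|
        ≤ ((1 + ξ) ^ i - 1) * ((#T).choose i / (d : ℝ) ^ i) := by
      have hpos : 0 < (d : ℝ) ^ i * M := by positivity
      rw [show b i / M - (#T).choose i / (d : ℝ) ^ i
        = ((d : ℝ) ^ i * b i - (#T).choose i * M) / ((d : ℝ) ^ i * M) by field_simp,
        abs_div, abs_of_pos hpos, div_le_iff₀ hpos]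
      refine h1.trans_eq ?_
      field_simp
    have h3 := abs_choose_div_pow_sub_le hd (hi.trans hKT) hT0
    set l : ℝ := (#T / d : ℝ) ^ i / i.factorial
    have hl : 0 ≤ l := by positivity
    have h4 : ((#T).choose i : ℝ) / (d : ℝ) ^ i ≤ l := by
      have := Nat.choose_le_pow_div (α := ℝ) i (#T)
      calc ((#T).choose i : ℝ) / (d : ℝ) ^ i ≤ (#T : ℝ) ^ i / i.factorial / (d : ℝ) ^ i := by
            gcongr
        _ = l := by simp only [l, div_pow]; field_simp
    have h5 : (1 + ξ) ^ i ≤ (1 + ξ) ^ K := pow_le_pow_right₀ (by linarith) hi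
    have h6 : 1 ≤ (1 + ξ) ^ i := one_le_pow₀ (by linarith)
    calc |b i / M - l| ≤ |b i / M - (#T).choose i / (d : ℝ) ^ i|
          + |(#T).choose i / (d : ℝ) ^ i - l| := abs_sub_le _ _ _
      _ ≤ ((1 + ξ) ^ i - 1) * ((#T).choose i / (d : ℝ) ^ i) + (i : ℝ) ^ 2 / #T * l :=
          add_le_add h2 h3
      _ ≤ ((1 + ξ) ^ K - 1) * l + (K : ℝ) ^ 2 / #T * l := by
          have : (i : ℝ) ≤ K := by exact_mod_cast hi
          have : 0 ≤ (1 + ξ) ^ K - 1 := by linarith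
          gcongr
      _ = _ := by ring
  · have hb : ∀ i, b i / M = (∑ σ ∈ pmSet G, ((#{t ∈ T | σ t = ρ t}).choose i : ℝ)) / M := by
      intro i
      congr 1
      have := sum_choose_card_eq_sum_agreeSet (G := G) (ρ := ρ) T i
      simp only [b]
      exact_mod_cast this.symm
    simp only [hb]
    have hp : (#{σ ∈ pmSet G | ∀ t ∈ T, σ t ≠ ρ t} : ℝ)
        = ∑ σ ∈ pmSet G, if #{t ∈ T | σ t = ρ t} = 0 then (1 : ℝ) else 0 := by
      rw [Finset.card_filter]
      push_cast
      simp [Finset.card_eq_zero, Finset.filter_eq_empty_iff]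
    have hs : ∑ i ∈ range K, (-1 : ℝ) ^ i
          * ((∑ σ ∈ pmSet G, ((#{t ∈ T | σ t = ρ t}).choose i : ℝ)) / M)
        = (∑ σ ∈ pmSet G, ∑ i ∈ range K,
          (-1 : ℝ) ^ i * ((#{t ∈ T | σ t = ρ t}).choose i : ℝ)) / M := by
      rw [Finset.sum_comm, Finset.sum_div]
      simp_rw [← mul_div_assoc, Finset.mul_sum]
    rw [hp, hs, ← sub_div, ← Finset.sum_sub_distrib, abs_div, abs_of_pos hM]
    gcongr
    exact (Finset.abs_sum_le_sum_abs _ _).trans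
      (Finset.sum_le_sum fun σ _ => abs_ite_sub_sum_choose_le _ _)

/-- The edges `s(x, σ x)` of the matching encoded by an involution `σ`. -/
def permEdges (σ : Equiv.Perm V) : Finset (Sym2 V) :=
  univ.image fun x => s(x, σ x)

theorem mk_mem_permEdges (hσ : ∀ x, σ (σ x) = x) {x y : V} :
    s(x, y) ∈ permEdges σ ↔ σ x = y := by
  simp only [permEdges, Finset.mem_image, Finset.mem_univ, true_and, Sym2.eq_iff]
  constructor
  · rintro ⟨z, ⟨rfl, h⟩ | ⟨rfl, h⟩⟩
    · exact h
    · rw [← h, hσ]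
  · exact fun h => ⟨x, Or.inl ⟨rfl, h⟩⟩

theorem isPM_permEdges (hσ : σ ∈ pmSet G) : IsPM G (permEdges σ) := by
  obtain ⟨h1, h2⟩ := mem_pmSet.1 hσ
  refine ⟨fun e he => ?_, fun v => ⟨s(v, σ v), ⟨(mk_mem_permEdges h1).2 rfl,
    Sym2.mem_mk_left _ _⟩, ?_⟩⟩
  · obtain ⟨x, -, rfl⟩ := Finset.mem_image.1 he
    exact h2 x
  · rintro e ⟨he, hve⟩
    obtain ⟨w, rfl⟩ := Sym2.mem_iff_exists.1 hve
    rw [(mk_mem_permEdges h1).1 he]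

theorem exists_mem_pmSet_of_isPM {M : Finset (Sym2 V)} (hM : IsPM G M) :
    ∃ σ ∈ pmSet G, permEdges σ = M := by
  have hex : ∀ v, ∃ w, s(v, w) ∈ M := by
    intro v
    obtain ⟨e, ⟨he, hve⟩, -⟩ := hM.2 v
    obtain ⟨w, rfl⟩ := Sym2.mem_iff_exists.1 hve
    exact ⟨w, he⟩
  choose f hf using hex
  have huniq : ∀ v w, s(v, w) ∈ M → f v = w := fun v w h =>
    Sym2.congr_right.1 ((hM.2 v).unique ⟨hf v, Sym2.mem_mk_left _ _⟩ ⟨h, Sym2.mem_mk_left _ _⟩)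
  have hinv : ∀ v, f (f v) = v := fun v => huniq _ _ (Sym2.eq_swap ▸ hf v)
  refine ⟨Function.Involutive.toPerm f hinv, mem_pmSet.2 ⟨hinv, fun v => hM.1 _ (hf v)⟩, ?_⟩
  ext e
  induction e using Sym2.ind with
  | _ x y =>
    rw [mk_mem_permEdges (σ := Function.Involutive.toPerm f hinv) hinv]
    exact ⟨fun h => h ▸ hf x, huniq x y⟩

theorem pmCount_eq_card_pmSet : pmCount G = #(pmSet G) := by
  rw [pmCount, Nat.subtype_card ((pmSet G).image permEdges), Finset.card_image_of_injOn]
  · intro σ hσ σ' hσ' h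
    ext x
    have hx := (mk_mem_permEdges (mem_pmSet.1 hσ).1 (x := x)).2 rfl
    rw [h] at hx
    exact ((mk_mem_permEdges (mem_pmSet.1 hσ').1).1 hx).symm
  · intro M
    rw [Finset.mem_image]
    exact ⟨fun ⟨σ, hσ, h⟩ => h ▸ isPM_permEdges hσ, exists_mem_pmSet_of_isPM⟩

theorem pmCount_deleteEdges_permEdges (hρ : ∀ x, ρ (ρ x) = x) :
    pmCount (G.deleteEdges (permEdges ρ : Set (Sym2 V)))
      = #{σ ∈ pmSet G | ∀ x, σ x ≠ ρ x} := by
  classical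
  rw [pmCount_eq_card_pmSet]
  congr 1
  ext σ
  simp only [mem_pmSet, Finset.mem_filter, SimpleGraph.deleteEdges_adj, Finset.mem_coe,
    mk_mem_permEdges hρ, forall_and, and_assoc, ne_comm (a := σ _), ne_eq]

end Count

theorem forall_ne_iff_forall_mem_ne {V : Type*} {ρ σ : Equiv.Perm V} {T : Finset V}
    (hρ : ∀ x, ρ (ρ x) = x) (hσ : ∀ x, σ (σ x) = x) (hT : ∀ x, x ∈ T ↔ ρ x ∉ T) :
    (∀ x, σ x ≠ ρ x) ↔ ∀ t ∈ T, σ t ≠ ρ t := by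
  refine ⟨fun h t _ => h t, fun h x hx => ?_⟩
  by_cases hxT : x ∈ T
  · exact h x hxT hx
  · have hρT : ρ x ∈ T := by rwa [hT, hρ]
    refine h _ hρT ?_
    rw [hρ, ← hx, hσ]

/-- If `G` is a `d`-regular robust `(ν,τ)`-expander on `n` vertices and
`N` is a perfect matching of `G`, then `pm(G - N)/pm(G) = (1 ± ε) e^{-n/(2d)}`. -/
theorem pm_ratio_delete_perfect_matching :
    ∀ δ : ℝ, 0 < δ →
    ∃ τ : ℝ, 0 < τ ∧
    ∀ ν : ℝ, 0 < ν →
    ∀ ε : ℝ, 0 < ε →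
    ∃ n₀ : ℕ, ∀ n : ℕ, n₀ ≤ n → Even n →
    ∀ d : ℕ, δ * (n : ℝ) ≤ (d : ℝ) →
    ∀ (V : Type) [Fintype V], Fintype.card V = n →
    ∀ G : SimpleGraph V, RegularDeg G d → RobustExpander G ν τ →
    ∀ N : Finset (Sym2 V), IsPM G N →
      0 < pmCount G ∧
      (1 - ε) * Real.exp (-(n : ℝ) / (2 * (d : ℝ))) ≤
        (pmCount (G.deleteEdges (↑N : Set (Sym2 V))) : ℝ) / (pmCount G : ℝ) ∧
      (pmCount (G.deleteEdges (↑N : Set (Sym2 V))) : ℝ) / (pmCount G : ℝ) ≤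
        (1 + ε) * Real.exp (-(n : ℝ) / (2 * (d : ℝ))) := by
  intro δ hδ
  refine ⟨δ / 2, half_pos hδ, fun ν hν ε hε => ?_⟩
  set L : ℝ := 1 / (2 * δ) with hL_def
  have hL : 0 < L := by positivity
  obtain ⟨K, hK1, hK2⟩ : ∃ K : ℕ, L / (K + 1) ≤ 1 / 2 ∧
      4 * (L ^ K / K.factorial) ≤ ε * Real.exp (-L) / 2 := by
    have h1 : ∀ᶠ K : ℕ in Filter.atTop, L ^ K / K.factorial < ε * Real.exp (-L) / 8 :=
      (FloorSemiring.tendsto_pow_div_factorial_atTop L).eventually_lt_const (by positivity)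
    have h2 : ∀ᶠ K : ℕ in Filter.atTop, 2 * L ≤ K :=
      tendsto_natCast_atTop_atTop.eventually_ge_atTop _
    obtain ⟨K, hK1, hK2⟩ := (h1.and h2).exists
    refine ⟨K, ?_, by linarith⟩
    rw [div_le_iff₀ (by positivity)]
    linarith
  set θ : ℝ := min 1 (ε * Real.exp (-L) / 2 / Real.exp L) with hθ_def
  have hθ : 0 < θ := by positivity
  have hθ1 : θ ≤ 1 := min_le_left _ _
  have hθL : θ * Real.exp L ≤ ε * Real.exp (-L) / 2 := by
    rw [← le_div_iff₀ (Real.exp_pos _)]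
    exact min_le_right _ _
  obtain ⟨ξ, hξK, hξ0, hξ1⟩ : ∃ ξ : ℝ, (1 + ξ) ^ K - 1 < θ / 2 ∧ 0 < ξ ∧ ξ ≤ 1 := by
    have hcont : Filter.Tendsto (fun ξ : ℝ => (1 + ξ) ^ K - 1) (nhds 0) (nhds 0) := by
      have : Continuous fun ξ : ℝ => (1 + ξ) ^ K - 1 := by fun_prop
      simpa using this.tendsto 0
    have h := (hcont.eventually_lt_const (half_pos hθ)).filter_mono
      (nhdsWithin_le_nhds (s := Set.Ioi 0))
    obtain ⟨ξ, h1, h2⟩ := (h.and (Ioc_mem_nhdsGT one_pos)).exists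
    exact ⟨ξ, h1, h2⟩
  obtain ⟨n₁, hn₁⟩ := exists_agreeSet_extension hδ hν hξ0 hξ1 (2 * K)
  obtain ⟨n₂, hn₂⟩ := exists_nat_ge ((K : ℝ) ^ 2 * 4 / θ)
  refine ⟨max (max n₁ n₂) (2 * K + 1), ?_⟩
  intro n hn _ d hδd V _ hVn G hreg hexp N hN
  classical
  subst hVn
  simp only [max_le_iff] at hn
  have hreg' : ∀ x, #(G.neighborFinset x) = d := by
    intro x
    rw [← hreg x]
    exact (Nat.subtype_card _ fun y => SimpleGraph.mem_neighborFinset G x y).symm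
  obtain ⟨ρ, hρ, rfl⟩ := exists_mem_pmSet_of_isPM hN
  obtain ⟨h1, h2⟩ := mem_pmSet.1 hρ
  obtain ⟨T, hT, hTn⟩ := exists_transversal h1 fun x => (h2 x).ne'
  have hTn' : (Fintype.card V : ℝ) = 2 * #T := by exact_mod_cast hTn.symm
  have hT0 : 0 < #T := by omega
  have hT0' : (0 : ℝ) < #T := by exact_mod_cast hT0
  have hd' : (0 : ℝ) < d := lt_of_lt_of_le (by rw [hTn']; positivity) hδd
  have hd : 0 < d := by exact_mod_cast hd'
  have hlL : (#T / d : ℝ) ≤ L := by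
    rw [hL_def, div_le_div_iff₀ hd' (by positivity)]
    rw [hTn'] at hδd
    linarith
  have hKT : (K : ℝ) ^ 2 / #T ≤ θ / 2 := by
    have h3 : (K : ℝ) ^ 2 * 4 / θ ≤ 2 * #T := by
      rw [← hTn']
      exact hn₂.trans (by exact_mod_cast hn.1.2)
    rw [div_le_iff₀ hθ] at h3
    rw [div_le_iff₀ hT0']
    linarith
  have hest := abs_card_avoid_div_sub_exp_le (L := L) hd hξ0.le hρ (fun x => (hT x).1) hT0
    (by omega) hlL hK1 (by linarith) (hn₁ V G d hn.1.1 hreg' hδd hexp ρ hρ)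
  have hfilter : ({σ ∈ pmSet G | ∀ x, σ x ≠ ρ x} : Finset _)
      = {σ ∈ pmSet G | ∀ t ∈ T, σ t ≠ ρ t} :=
    Finset.filter_congr fun σ hσ => forall_ne_iff_forall_mem_ne h1 (mem_pmSet.1 hσ).1 hT
  rw [← hfilter, ← pmCount_deleteEdges_permEdges h1, ← pmCount_eq_card_pmSet] at hest
  have hlam : -(Fintype.card V : ℝ) / (2 * d) = -(#T / d : ℝ) := by
    rw [hTn', neg_div, mul_div_mul_left _ _ two_ne_zero]
  have herr : ((1 + ξ) ^ K - 1 + (K : ℝ) ^ 2 / #T) * Real.exp L + 4 * (L ^ K / K.factorial)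
      ≤ ε * Real.exp (-(#T / d : ℝ)) := by
    calc _ ≤ θ * Real.exp L + 4 * (L ^ K / K.factorial) := by gcongr; linarith
      _ ≤ ε * Real.exp (-L) := by linarith
      _ ≤ _ := by gcongr
  have habs := abs_le.1 (hest.trans herr)
  rw [hlam]
  refine ⟨?_, by linarith [habs.1], by linarith [habs.2]⟩
  rw [pmCount_eq_card_pmSet]
  exact Finset.card_pos.2 ⟨ρ, hρ⟩

end RPM
end

section
/- For every δ ∈ (0,1] there exists τ₀ > 0 such that for all τ, ν with 0 < ν ≤ τ ≤ τ₀ there exist ε₀ > 0 and n₀ ∈ ℕ with the following property: for every n ≥ n₀, every f with 1/n ≤ f ≤ ε₀, and every (δ,f)-almost regular robust (ν,τ)-outexpander D on n vertices such that (1−f^{1/2})δn is an integer, D contains a spanning subdigraph in which every vertex has in- and outdegree exactly (1−f^{1/2})δn and which is a robust (ν/2, τ)-outexpander. -/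
open Finset

namespace RPM

/-- The `ν`-robust outneighbourhood of a vertex set `S` in a digraph `D` on `n` vertices:
all vertices having at least `ν * n` inneighbours in `S`. -/
def RNplus {V : Type*} [Fintype V] (D : V → V → Prop) (ν : ℝ) (S : Set V) : Set V :=
  {v : V | ν * (Fintype.card V : ℝ) ≤ (Nat.card {u : V | u ∈ S ∧ D u v} : ℝ)}

/-- `D` is a robust `(ν, τ)`-outexpander. -/
def RobustOutexpander {V : Type*} [Fintype V] (D : V → V → Prop) (ν τ : ℝ) : Prop :=
  ∀ S : Set V,
    τ * (Fintype.card V : ℝ) ≤ (Nat.card S : ℝ) →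
    (Nat.card S : ℝ) ≤ (1 - τ) * (Fintype.card V : ℝ) →
    (Nat.card S : ℝ) + ν * (Fintype.card V : ℝ) ≤ (Nat.card (RNplus D ν S) : ℝ)

/-- Out-degree of a vertex in a digraph. -/
noncomputable def outDeg {V : Type*} (D : V → V → Prop) (v : V) : ℕ :=
  Nat.card {u : V | D v u}

/-- In-degree of a vertex in a digraph. -/
noncomputable def inDeg {V : Type*} (D : V → V → Prop) (v : V) : ℕ :=
  Nat.card {u : V | D u v}

/-- `D` is `(δ, f)`-almost regular: all in- and out-degrees lie in `[(1-f)δn, (1+f)δn]`. -/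
def AlmostRegular {V : Type*} [Fintype V] (D : V → V → Prop) (δ f : ℝ) : Prop :=
  ∀ v : V,
    ((1 - f) * δ * (Fintype.card V : ℝ) ≤ (outDeg D v : ℝ) ∧
      (outDeg D v : ℝ) ≤ (1 + f) * δ * (Fintype.card V : ℝ)) ∧
    ((1 - f) * δ * (Fintype.card V : ℝ) ≤ (inDeg D v : ℝ) ∧
      (inDeg D v : ℝ) ≤ (1 + f) * δ * (Fintype.card V : ℝ))

/-- The number of directed walks of length `ℓ` from `u` to `v` in the digraph `D`,
encoded as functions `Fin (ℓ+1) → V`. -/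
noncomputable def walkCount {V : Type*} (D : V → V → Prop) (u v : V) (ℓ : ℕ) : ℕ :=
  Nat.card {w : Fin (ℓ + 1) → V // w 0 = u ∧ w (Fin.last ℓ) = v ∧
    ∀ i : Fin ℓ, D (w i.castSucc) (w i.succ)}

section Counting

variable {V : Type*}

open scoped Classical in
/-- The number of edges of `D` from `S` to `T`. -/
noncomputable def edgeCount (D : V → V → Prop) (S T : Finset V) : ℕ :=
  ∑ u ∈ S, #{v ∈ T | D u v}

open scoped Classical in
lemma edgeCount_eq_sum_in (D : V → V → Prop) (S T : Finset V) :
    edgeCount D S T = ∑ v ∈ T, #{u ∈ S | D u v} :=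
  sum_card_bipartiteAbove_eq_sum_card_bipartiteBelow D

lemma edgeCount_le_mul (D : V → V → Prop) (S T : Finset V) : edgeCount D S T ≤ #S * #T := by
  classical
  refine (sum_le_card_nsmul S _ #T fun u _ => card_filter_le _ _).trans ?_
  simp

variable [Fintype V]

lemma outDeg_eq_card (D : V → V → Prop) (v : V) [DecidablePred fun u => D v u] :
    outDeg D v = #{u | D v u} := by
  rw [outDeg, Nat.card_coe_set_eq, Set.ncard_eq_toFinset_card']
  simp

lemma inDeg_eq_card (D : V → V → Prop) (v : V) [DecidablePred fun u => D u v] :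
    inDeg D v = #{u | D u v} := by
  rw [inDeg, Nat.card_coe_set_eq, Set.ncard_eq_toFinset_card']
  simp

open scoped Classical in
lemma edgeCount_add_compl_right (D : V → V → Prop) (S T : Finset V) :
    edgeCount D S T + edgeCount D S Tᶜ = ∑ u ∈ S, outDeg D u := by
  simp only [edgeCount, ← sum_add_distrib, outDeg_eq_card]
  refine sum_congr rfl fun u _ => ?_
  rw [← card_union_of_disjoint, ← filter_union, union_compl]
  exact disjoint_filter_filter disjoint_compl_right

open scoped Classical in
lemma edgeCount_add_compl_left (D : V → V → Prop) (S T : Finset V) :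
    edgeCount D S T + edgeCount D Sᶜ T = ∑ v ∈ T, inDeg D v := by
  simp only [edgeCount_eq_sum_in, ← sum_add_distrib, inDeg_eq_card]
  refine sum_congr rfl fun u _ => ?_
  rw [← card_union_of_disjoint, ← filter_union, union_compl]
  exact disjoint_filter_filter disjoint_compl_right

lemma edgeCount_le_sum_inDeg (D : V → V → Prop) (S T : Finset V) :
    edgeCount D S T ≤ ∑ v ∈ T, inDeg D v :=
  (Nat.le_add_right _ _).trans (edgeCount_add_compl_left D S T).le

end Counting

section Factor

variable {V : Type*} [Fintype V]

/-- A digraph satisfying the Ore-Ryser cut condition contains a spanning `m`-regular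
subdigraph. The proof applies Hall's theorem with the edges as representatives: every vertex
claims `m` out-edges to be kept and all but `m` of its in-edges to be discarded. -/
theorem exists_regular_subdigraph (D : V → V → Prop) (m : ℕ) (hin : ∀ v, m ≤ inDeg D v)
    (hcut : ∀ S T : Finset V, (m : ℤ) * ((#S : ℤ) + #T - Fintype.card V) ≤ edgeCount D S T) :
    ∃ D' : V → V → Prop, (∀ u v, D' u v → D u v) ∧ ∀ v, outDeg D' v = m ∧ inDeg D' v = m := by
  classical
  let ι := (V × Fin m) ⊕ (Σ v : V, Fin (inDeg D v - m))
  let t : ι → Finset (V × V) := Sum.elim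
    (fun p => univ.filter fun e => D e.1 e.2 ∧ e.1 = p.1)
    (fun p => univ.filter fun e => D e.1 e.2 ∧ e.2 = p.1)
  have hall : ∀ s : Finset ι, #s ≤ #(s.biUnion t) := by
    intro s
    let S : Finset V := s.toLeft.image Prod.fst
    let T : Finset V := s.toRight.image Sigma.fst
    have hs1 : #s.toLeft ≤ #S * m := by
      calc #s.toLeft ≤ #(S ×ˢ (univ : Finset (Fin m))) :=
            card_le_card fun p hp =>
              mem_product.2 ⟨mem_image_of_mem Prod.fst hp, mem_univ _⟩
        _ = #S * m := by simp
    have hs2 : #s.toRight ≤ ∑ v ∈ T, (inDeg D v - m) := by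
      calc #s.toRight ≤ #(T.sigma fun v => (univ : Finset (Fin (inDeg D v - m)))) :=
            card_le_card fun p hp =>
              mem_sigma.2 ⟨mem_image_of_mem Sigma.fst hp, mem_univ _⟩
        _ = _ := by simp
    have hs : #s = #s.toLeft + #s.toRight := (card_toLeft_add_card_toRight).symm
    let E₁ : Finset (V × V) := T.biUnion fun v =>
      ({u | D u v} : Finset V).image fun u => (u, v)
    let E₂ : Finset (V × V) := S.biUnion fun u => {v ∈ Tᶜ | D u v}.image fun v => (u, v)
    have hE₁ : #E₁ = ∑ v ∈ T, inDeg D v := by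
      rw [card_biUnion]
      · refine sum_congr rfl fun v _ => ?_
        rw [inDeg_eq_card, card_image_of_injective _ (Prod.mk_left_injective v)]
      · intro v _ w _ hvw
        rw [Function.onFun, disjoint_left]
        simp only [mem_image, not_exists, not_and]
        rintro _ ⟨u, _, rfl⟩ u' _ h
        exact hvw (Prod.ext_iff.1 h).2.symm
    have hE₂ : #E₂ = edgeCount D S Tᶜ := by
      rw [card_biUnion]
      · refine sum_congr rfl fun v _ => ?_
        rw [card_image_of_injective _ (Prod.mk_right_injective v)]
      · intro v _ w _ hvw
        rw [Function.onFun, disjoint_left]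
        simp only [mem_image, not_exists, not_and]
        rintro _ ⟨u, _, rfl⟩ u' _ h
        exact hvw (Prod.ext_iff.1 h).1.symm
    have hdisj : Disjoint E₁ E₂ := by
      rw [disjoint_left]
      simp only [E₁, E₂, mem_biUnion, mem_image, mem_filter, mem_compl]
      rintro _ ⟨v, hv, u, _, rfl⟩ ⟨u', _, v', ⟨hv', _⟩, h⟩
      obtain rfl : v' = v := (Prod.ext_iff.1 h).2
      exact hv' hv
    have hsub : E₁ ∪ E₂ ⊆ s.biUnion t := by
      intro e he
      rw [mem_biUnion]
      rcases mem_union.1 he with he | he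
      · simp only [E₁, mem_biUnion, mem_image, mem_filter, mem_univ, true_and] at he
        obtain ⟨v, hv, u, huv, rfl⟩ := he
        obtain ⟨p, hp, rfl⟩ := mem_image.1 hv
        exact ⟨Sum.inr p, mem_toRight.1 hp, by simp [t, huv]⟩
      · simp only [E₂, mem_biUnion, mem_image, mem_filter] at he
        obtain ⟨u, hu, v, ⟨_, huv⟩, rfl⟩ := he
        obtain ⟨p, hp, rfl⟩ := mem_image.1 hu
        exact ⟨Sum.inl p, mem_toLeft.1 hp, by simp [t, huv]⟩
    have hcard := card_le_card hsub
    rw [card_union_of_disjoint hdisj, hE₁, hE₂] at hcard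
    have hsum : ∑ v ∈ T, (inDeg D v - m) + #T * m = ∑ v ∈ T, inDeg D v := by
      rw [← smul_eq_mul, ← sum_const, ← sum_add_distrib]
      exact sum_congr rfl fun v _ => Nat.sub_add_cancel (hin v)
    have hc := hcut S Tᶜ
    have hT : (#Tᶜ : ℤ) = Fintype.card V - #T := by
      have := card_compl_add_card T
      omega
    rw [hT] at hc
    have hc' : #S * m ≤ #T * m + edgeCount D S Tᶜ := by
      zify
      linarith
    omega
  obtain ⟨g, hg, hgt⟩ := (all_card_le_biUnion_card_iff_exists_injective t).1 hall
  have hgl : ∀ u i, D (g (.inl (u, i))).1 (g (.inl (u, i))).2 ∧ (g (.inl (u, i))).1 = u := by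
    intro u i
    simpa [t] using hgt (.inl (u, i))
  have hgr : ∀ v j, D (g (.inr ⟨v, j⟩)).1 (g (.inr ⟨v, j⟩)).2 ∧ (g (.inr ⟨v, j⟩)).2 = v := by
    intro v j
    simpa [t] using hgt (.inr ⟨v, j⟩)
  let D' : V → V → Prop := fun u v => ∃ i, g (.inl (u, i)) = (u, v)
  have hsub : ∀ u v, D' u v → D u v := by
    rintro u v ⟨i, hi⟩
    simpa [hi] using (hgl u i).1
  have hout : ∀ u, outDeg D' u = m := by
    intro u
    have : ({v | D' u v} : Finset V) = univ.image fun i : Fin m => (g (.inl (u, i))).2 := by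
      ext v
      simp only [D', mem_filter, mem_univ, true_and, mem_image]
      exact exists_congr fun i => ⟨fun h => by rw [h], fun h => Prod.ext (hgl u i).2 h⟩
    rw [outDeg_eq_card, this, card_image_of_injective, card_univ, Fintype.card_fin]
    intro i j hij
    have := hg (Prod.ext ((hgl u i).2.trans (hgl u j).2.symm) hij)
    exact (Prod.mk.inj (Sum.inl.inj this)).2
  have hin_le : ∀ v, inDeg D' v ≤ m := by
    intro v
    let R : Finset V := univ.image fun j : Fin (inDeg D v - m) => (g (.inr ⟨v, j⟩)).1
    have hR : #R = inDeg D v - m := by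
      rw [card_image_of_injective, card_univ, Fintype.card_fin]
      intro i j hij
      have := hg (Prod.ext hij ((hgr v i).2.trans (hgr v j).2.symm))
      exact eq_of_heq (Sigma.mk.inj (Sum.inr.inj this)).2
    have hd : Disjoint ({u | D' u v} : Finset V) R := by
      rw [disjoint_left]
      simp only [R, D', mem_filter, mem_univ, true_and, mem_image, not_exists]
      rintro u ⟨i, hi⟩ j hj
      have := hg (hi.trans (Prod.ext hj (hgr v j).2).symm)
      simp at this
    have hU : ({u | D' u v} : Finset V) ∪ R ⊆ ({u | D u v} : Finset V) := by
      refine union_subset (fun u hu => ?_) (fun u hu => ?_)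
      · simp only [mem_filter, mem_univ, true_and] at hu ⊢
        exact hsub u v hu
      · obtain ⟨j, _, rfl⟩ := mem_image.1 hu
        have := (hgr v j).1
        rw [(hgr v j).2] at this
        simpa using this
    have := card_le_card hU
    rw [card_union_of_disjoint hd, hR, ← inDeg_eq_card, ← inDeg_eq_card] at this
    have := hin v
    omega
  have hsum : ∑ v, inDeg D' v = ∑ _v : V, m := by
    have h₁ := edgeCount_add_compl_left D' univ univ
    have h₂ := edgeCount_add_compl_right D' univ univ
    simp only [compl_univ] at h₁ h₂
    have h₃ : edgeCount D' univ ∅ = 0 := by simp [edgeCount]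
    have h₄ : edgeCount D' ∅ univ = 0 := by simp [edgeCount]
    simp only [hout] at h₂
    omega
  have hin_eq := (sum_eq_sum_iff_of_le fun v _ => hin_le v).1 hsum
  exact ⟨D', hsub, fun v => ⟨hout v, hin_eq v (mem_univ v)⟩⟩

end Factor

section Expander

variable {V : Type*} [Fintype V]

/-- A set which robustly expands sends many edges to every set that is not too small. -/
lemma RobustOutexpander.le_edgeCount {D : V → V → Prop} {ν τ : ℝ} (hν : 0 ≤ ν)
    (hD : RobustOutexpander D ν τ) (S T : Finset V)
    (h₁ : τ * Fintype.card V ≤ #S) (h₂ : (#S : ℝ) ≤ (1 - τ) * Fintype.card V) :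
    ν * Fintype.card V * (#S + #T - Fintype.card V + ν * Fintype.card V) ≤ edgeCount D S T := by
  classical
  have hexp := hD (S : Set V) (by simpa using h₁) (by simpa using h₂)
  set R : Finset V := (RNplus D ν (S : Set V)).toFinset with hR
  have hRcard : Nat.card (RNplus D ν (S : Set V)) = #R := by
    rw [Nat.card_coe_set_eq, Set.ncard_eq_toFinset_card']
  rw [hRcard] at hexp
  simp only [Nat.card_eq_fintype_card, Fintype.card_coe, SetLike.coe_sort_coe] at hexp
  have hinter : (#R : ℝ) + #T - Fintype.card V ≤ #(R ∩ T) := by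
    have h := card_union_add_card_inter R T
    have h' := card_le_univ (R ∪ T)
    have : #R + #T ≤ #(R ∩ T) + Fintype.card V := by omega
    have : (#R : ℝ) + #T ≤ #(R ∩ T) + Fintype.card V := by exact_mod_cast this
    linarith
  have hdeg : ∀ v ∈ R ∩ T, ν * Fintype.card V ≤ (#{u ∈ S | D u v} : ℝ) := by
    intro v hv
    have hv' : v ∈ RNplus D ν (S : Set V) := by
      simpa [hR] using (mem_inter.1 hv).1
    rw [RNplus, Set.mem_ofPred_eq, Nat.card_coe_set_eq, Set.ncard_eq_toFinset_card'] at hv'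
    convert hv' using 3
    ext u
    simp
  have hn : 0 ≤ ν * Fintype.card V := by positivity
  calc ν * Fintype.card V * (#S + #T - Fintype.card V + ν * Fintype.card V)
      ≤ ν * Fintype.card V * #(R ∩ T) := mul_le_mul_of_nonneg_left (by linarith) hn
    _ = ∑ _v ∈ R ∩ T, ν * (Fintype.card V : ℝ) := by rw [sum_const, nsmul_eq_mul, mul_comm]
    _ ≤ ∑ v ∈ R ∩ T, (#{u ∈ S | D u v} : ℝ) := sum_le_sum hdeg
    _ ≤ ∑ v ∈ T, (#{u ∈ S | D u v} : ℝ) :=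
        sum_le_sum_of_subset_of_nonneg inter_subset_right fun _ _ _ => by positivity
    _ = edgeCount D S T := by rw [edgeCount_eq_sum_in]; push_cast; rfl

/-- Robust outexpansion survives the removal of few in-edges at every vertex. -/
lemma RobustOutexpander.of_subdigraph {D D' : V → V → Prop} {ν ν' τ : ℝ} (hν : ν' ≤ ν)
    (hD : RobustOutexpander D ν τ) (hsub : ∀ u v, D' u v → D u v)
    (hdeg : ∀ v, (inDeg D v : ℝ) - inDeg D' v ≤ (ν - ν') * Fintype.card V) :
    RobustOutexpander D' ν' τ := by
  classical
  intro S h₁ h₂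
  have hmono : RNplus D ν S ⊆ RNplus D' ν' S := by
    intro v hv
    simp only [RNplus, Set.mem_ofPred_eq] at hv ⊢
    have key : Nat.card {u | u ∈ S ∧ D u v} + inDeg D' v ≤
        Nat.card {u | u ∈ S ∧ D' u v} + inDeg D v := by
      simp only [inDeg, Nat.card_coe_set_eq]
      rw [← Set.ncard_inter_add_ncard_union {u | u ∈ S ∧ D u v} {u | D' u v}]
      refine add_le_add (Set.ncard_le_ncard ?_) (Set.ncard_le_ncard ?_)
      · rintro u ⟨⟨hu, _⟩, hu'⟩
        exact ⟨hu, hu'⟩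
      · rintro u (⟨_, hu⟩ | hu)
        · exact hu
        · exact hsub u v hu
    have key' : (Nat.card {u | u ∈ S ∧ D u v} : ℝ) + inDeg D' v ≤
        Nat.card {u | u ∈ S ∧ D' u v} + inDeg D v := by exact_mod_cast key
    linarith [hdeg v]
  have hle : (Nat.card (RNplus D ν S) : ℝ) ≤ Nat.card (RNplus D' ν' S) := by
    exact_mod_cast Set.ncard_le_ncard hmono
  have := hD S h₁ h₂
  have : ν' * (Fintype.card V : ℝ) ≤ ν * Fintype.card V := by gcongr
  linarith

/-- The numerical content of the cut condition for almost regular robust outexpanders. -/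
lemma mul_le_of_degree_bounds_of_expansion {δ ν τ r n s t e : ℝ} (hδ₀ : 0 < δ) (hδ₁ : δ ≤ 1)
    (hν : 0 < ν) (hντ : ν ≤ τ) (hτ : τ ≤ δ / 4) (hr₀ : 0 ≤ r) (hr : r ≤ ν ^ 2 / 2)
    (he : 0 ≤ e) (hs₀ : 0 ≤ s) (ht₀ : 0 ≤ t) (hsn : s ≤ n) (htn : t ≤ n)
    (hout : s * ((1 - r ^ 2) * δ * n) ≤ e + s * (n - t))
    (hin : t * ((1 - r ^ 2) * δ * n) ≤ e + (n - s) * t)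
    (hbal : s * ((1 - r ^ 2) * δ * n) ≤ e + (n - t) * ((1 + r ^ 2) * δ * n))
    (hexp : τ * n ≤ s → s ≤ (1 - τ) * n → ν * n * (s + t - n + ν * n) ≤ e) :
    (1 - r) * δ * n * (s + t - n) ≤ e := by
  have hn₀ : 0 ≤ n := hs₀.trans hsn
  have hν₁ : ν ≤ 1 / 4 := by linarith
  have hνδ : ν ^ 2 ≤ δ / 16 := by nlinarith
  have hr₁ : r ≤ 1 / 32 := by linarith
  have hrr : r ^ 2 ≤ r := by nlinarith
  have hδn : 0 ≤ δ * n := by positivity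
  have hrδn : 0 ≤ (r - r ^ 2) * (δ * n) := mul_nonneg (by linarith) hδn
  have hrn : 0 ≤ r * n := by positivity
  have hm₀ : 0 ≤ (1 - r) * δ * n := by
    have : 0 ≤ 1 - r := by linarith
    positivity
  by_cases hsm : s ≤ (1 - r) * δ * n
  · have h₁ := mul_nonneg (sub_nonneg.2 htn) (sub_nonneg.2 hsm)
    have h₂ := mul_nonneg hrδn hs₀
    linarith
  by_cases htm : t ≤ (1 - r) * δ * n
  · have h₁ := mul_nonneg (sub_nonneg.2 hsn) (sub_nonneg.2 htm)
    have h₂ := mul_nonneg hrδn ht₀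
    linarith
  by_cases hst : 2 * r * n ≤ s + t - n
  · have h₁ : 0 ≤ (r * (δ * n)) * ((s + t - n) - r * (s + (n - t))) := by
      refine mul_nonneg (by positivity) ?_
      have : r * (s + (n - t)) ≤ r * (2 * n) := mul_le_mul_of_nonneg_left (by linarith) hr₀
      linarith
    linarith
  push Not at hsm htm hst
  rcases le_total (s + t - n) 0 with h | h
  · exact (mul_nonpos_of_nonneg_of_nonpos hm₀ h).trans he
  have hτm : τ * n + 2 * r * n ≤ (1 - r) * δ * n := by
    have hrδ : r * δ ≤ 1 / 32 * δ := by gcongr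
    have : τ + 2 * r ≤ (1 - r) * δ := by linarith
    linarith [mul_le_mul_of_nonneg_right this hn₀]
  have hδr : (1 - r) * δ ≤ 1 := mul_le_one₀ (by linarith) hδ₀.le hδ₁
  calc (1 - r) * δ * n * (s + t - n) ≤ n * (ν ^ 2 * n) := by
        refine mul_le_mul ?_ ?_ h hn₀
        · linarith [mul_le_mul_of_nonneg_right hδr hn₀]
        · linarith [mul_le_mul_of_nonneg_right hr hn₀]
    _ ≤ ν * n * (s + t - n + ν * n) := by
        have : 0 ≤ ν * n * (s + t - n) := by positivity
        linarith
    _ ≤ e := hexp (by linarith) (by linarith)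

/-- The cut condition for almost regular robust outexpanders. -/
lemma RobustOutexpander.cut_le_edgeCount {D : V → V → Prop} {δ ν τ r : ℝ} (hδ₀ : 0 < δ)
    (hδ₁ : δ ≤ 1) (hν : 0 < ν) (hντ : ν ≤ τ) (hτ : τ ≤ δ / 4) (hr₀ : 0 ≤ r)
    (hr : r ≤ ν ^ 2 / 2) (hreg : AlmostRegular D δ (r ^ 2)) (hD : RobustOutexpander D ν τ)
    (S T : Finset V) :
    (1 - r) * δ * Fintype.card V * (#S + #T - Fintype.card V) ≤ edgeCount D S T := by
  classical
  have hSc : (#Sᶜ : ℝ) = Fintype.card V - #S := by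
    have : (#Sᶜ : ℝ) + #S = Fintype.card V := by exact_mod_cast card_compl_add_card S
    linarith
  have hTc : (#Tᶜ : ℝ) = Fintype.card V - #T := by
    have : (#Tᶜ : ℝ) + #T = Fintype.card V := by exact_mod_cast card_compl_add_card T
    linarith
  have hout : #S * ((1 - r ^ 2) * δ * Fintype.card V) ≤
      (edgeCount D S T : ℝ) + edgeCount D S Tᶜ := by
    have h := card_nsmul_le_sum S (fun u => (outDeg D u : ℝ)) _ fun u _ => (hreg u).1.1
    rw [nsmul_eq_mul] at h
    exact h.trans_eq (by exact_mod_cast (edgeCount_add_compl_right D S T).symm)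
  have hin : #T * ((1 - r ^ 2) * δ * Fintype.card V) ≤
      (edgeCount D S T : ℝ) + edgeCount D Sᶜ T := by
    have h := card_nsmul_le_sum T (fun u => (inDeg D u : ℝ)) _ fun u _ => (hreg u).2.1
    rw [nsmul_eq_mul] at h
    exact h.trans_eq (by exact_mod_cast (edgeCount_add_compl_left D S T).symm)
  have hout_le : (edgeCount D S Tᶜ : ℝ) ≤ #S * (Fintype.card V - #T) := by
    rw [← hTc]
    exact_mod_cast edgeCount_le_mul D S Tᶜ
  have hin_le : (edgeCount D Sᶜ T : ℝ) ≤ (Fintype.card V - #S) * #T := by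
    rw [← hSc]
    exact_mod_cast edgeCount_le_mul D Sᶜ T
  have hbal : (edgeCount D S Tᶜ : ℝ) ≤
      (Fintype.card V - #T) * ((1 + r ^ 2) * δ * Fintype.card V) := by
    have h := sum_le_card_nsmul Tᶜ (fun u => (inDeg D u : ℝ)) _ fun u _ => (hreg u).2.2
    rw [nsmul_eq_mul, hTc] at h
    exact le_trans (by exact_mod_cast edgeCount_le_sum_inDeg D S Tᶜ) h
  exact mul_le_of_degree_bounds_of_expansion hδ₀ hδ₁ hν hντ hτ hr₀ hr (by positivity)
    (by positivity) (by positivity) (by exact_mod_cast card_le_univ S)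
    (by exact_mod_cast card_le_univ T) (by linarith) (by linarith) (by linarith)
    (hD.le_edgeCount hν.le S T)

end Expander

/-- An almost regular robust outexpander contains a spanning regular
subdigraph of similar degree which is still a robust outexpander. -/
theorem almost_regular_contains_regular_outexpander :
    ∀ δ : ℝ, 0 < δ → δ ≤ 1 →
    ∃ τ₀ : ℝ, 0 < τ₀ ∧
    ∀ τ ν : ℝ, 0 < ν → ν ≤ τ → τ ≤ τ₀ →
    ∃ ε₀ : ℝ, 0 < ε₀ ∧
    ∃ n₀ : ℕ, ∀ n : ℕ, n₀ ≤ n →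
    ∀ f : ℝ, 1 / (n : ℝ) ≤ f → f ≤ ε₀ →
    ∀ (V : Type) [Fintype V], Fintype.card V = n →
    ∀ D : V → V → Prop, AlmostRegular D δ f → RobustOutexpander D ν τ →
    ∀ m : ℕ, (m : ℝ) = (1 - Real.sqrt f) * δ * (n : ℝ) →
      ∃ D' : V → V → Prop,
        (∀ u v : V, D' u v → D u v) ∧
        (∀ v : V, outDeg D' v = m ∧ inDeg D' v = m) ∧
        RobustOutexpander D' (ν / 2) τ := by
  intro δ hδ₀ hδ₁
  refine ⟨δ / 4, by positivity, fun τ ν hν hντ hτ => ⟨(ν ^ 2 / 2) ^ 2, by positivity, 0, ?_⟩⟩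
  rintro n - f hf₀ hf V _ rfl D hreg hD m hm
  have hf_nonneg : 0 ≤ f := le_trans (by positivity) hf₀
  obtain ⟨r, hr₀, rfl⟩ : ∃ r : ℝ, 0 ≤ r ∧ f = r ^ 2 :=
    ⟨√f, Real.sqrt_nonneg f, (Real.sq_sqrt hf_nonneg).symm⟩
  rw [Real.sqrt_sq hr₀] at hm
  have hr : r ≤ ν ^ 2 / 2 := le_of_sq_le_sq hf (by positivity)
  have hν₁ : ν ≤ 1 / 4 := by linarith
  have hνν : ν ^ 2 ≤ ν / 4 := by nlinarith
  have hrr : r ^ 2 ≤ r := by nlinarith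
  have hδn : 0 ≤ δ * Fintype.card V := by positivity
  obtain ⟨D', hsub, hdeg⟩ := exists_regular_subdigraph D m
    (fun v => by
      have := (hreg v).2.1
      have h : (m : ℝ) ≤ inDeg D v := by nlinarith
      exact_mod_cast h)
    (fun S T => by
      have := hD.cut_le_edgeCount hδ₀ hδ₁ hν hντ hτ hr₀ hr hreg S T
      rw [← hm] at this
      exact_mod_cast this)
  refine ⟨D', hsub, hdeg, hD.of_subdigraph (by linarith) hsub fun v => ?_⟩
  rw [(hdeg v).2, hm]
  have h₁ := (hreg v).2.2
  have h₂ : (r ^ 2 + r) * (δ * Fintype.card V) ≤ ν / 2 * Fintype.card V := by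
    calc (r ^ 2 + r) * (δ * Fintype.card V) ≤ ν / 2 * (1 * Fintype.card V) := by
          gcongr
          linarith
      _ = _ := by ring
  linarith

end RPM
end

section
/- Let (X_t)_{t≥0} be a Markov chain with state space [n] = {1,…,n} and transition matrix P satisfying P(i,j) ≠ 0 for all i, j ∈ [n], and with (unique) stationary distribution (σ_i)_{i∈[n]} satisfying σ_i ≠ 0 for all i ∈ [n]. Let α := min_{i,j,k∈[n]} P(i,j)/σ_k and β := max_{i,j,k∈[n]} P(i,j)/σ_k. Then for every integer t ≥ 2 + 2α^{−1}·log β and every i ∈ [n], one has |P[X_t = i] − σ_i| ≤ (1 − α/2)^t · σ_i. -/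
open MeasureTheory

/-- One-step law of total probability for a chain on a finite state space. -/
lemma measureReal_succ_eq_sum {Ω ι : Type*} [MeasurableSpace Ω] (μ : Measure Ω)
    [IsFiniteMeasure μ] [Fintype ι] [MeasurableSpace ι] [MeasurableSingletonClass ι]
    {X Y : Ω → ι} (hX : Measurable X) (hY : Measurable Y) {P : Matrix ι ι ℝ}
    (hP : ∀ i j, 0 ≤ P i j)
    (hMarkov : ∀ i j, μ {ω | Y ω = j ∧ X ω = i} = ENNReal.ofReal (P i j) * μ {ω | X ω = i})
    (j : ι) :
    μ.real {ω | Y ω = j} = ∑ i, μ.real {ω | X ω = i} * P i j := by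
  have hunion : {ω | Y ω = j} = ⋃ i ∈ (Finset.univ : Finset ι), {ω | Y ω = j ∧ X ω = i} := by
    ext ω
    simp
  have hmeas (k : ι) : MeasurableSet {ω | Y ω = j ∧ X ω = k} :=
    (hY (measurableSet_singleton j)).inter (hX (measurableSet_singleton k))
  have hdisj : Set.PairwiseDisjoint (↑(Finset.univ : Finset ι))
      fun i => {ω | Y ω = j ∧ X ω = i} := by
    intro a _ b _ hab
    refine Set.disjoint_left.2 fun ω ha hb => hab ?_
    exact ha.2.symm.trans hb.2
  rw [hunion, measureReal_biUnion_finset hdisj fun k _ => hmeas k]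
  refine Finset.sum_congr rfl fun k _ => ?_
  rw [measureReal_def, hMarkov, ENNReal.toReal_mul, ENNReal.toReal_ofReal (hP k j),
    measureReal_def, mul_comm]

lemma sum_measureReal_fiber {Ω ι : Type*} [MeasurableSpace Ω] (μ : Measure Ω)
    [IsProbabilityMeasure μ] [Fintype ι] [MeasurableSpace ι] [MeasurableSingletonClass ι]
    {X : Ω → ι} (hX : Measurable X) : ∑ i, μ.real {ω | X ω = i} = 1 := by
  have h := sum_measureReal_preimage_singleton (μ := μ) (f := X) Finset.univ
    fun y _ => hX (measurableSet_singleton y)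
  simpa [Set.preimage] using h

/-- A Doeblin minorization contracts the weighted sup norm of mass-zero signed vectors. -/
lemma abs_sum_mul_le_of_minorization {ι : Type*} [Fintype ι] {P : Matrix ι ι ℝ} {σ d : ι → ℝ}
    {a r : ℝ} (hσ : ∑ i, σ i = 1) (hstat : ∀ j, ∑ i, σ i * P i j = σ j)
    (hminor : ∀ i j, a * σ j ≤ P i j) (hd : ∑ i, d i = 0) (hr : ∀ i, |d i| ≤ r * σ i) (j : ι) :
    |∑ i, d i * P i j| ≤ (1 - a) * r * σ j := by
  calc |∑ i, d i * P i j| = |∑ i, d i * (P i j - a * σ j)| := by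
        simp [mul_sub, Finset.sum_sub_distrib, ← Finset.sum_mul, hd]
    _ ≤ ∑ i, |d i * (P i j - a * σ j)| := Finset.abs_sum_le_sum_abs _ _
    _ ≤ ∑ i, r * σ i * (P i j - a * σ j) := by
        refine Finset.sum_le_sum fun i _ => ?_
        have h := sub_nonneg.2 (hminor i j)
        rw [abs_mul, abs_of_nonneg h]
        exact mul_le_mul_of_nonneg_right (hr i) h
    _ = r * (∑ i, σ i * P i j - (∑ i, σ i) * (a * σ j)) := by
        rw [Finset.sum_mul, ← Finset.sum_sub_distrib, Finset.mul_sum]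
        exact Finset.sum_congr rfl fun i _ => by ring
    _ = (1 - a) * r * σ j := by
        rw [hstat, hσ]
        ring

lemma pow_mul_le_half_pow {a b : ℝ} (ha : 0 < a) (ha1 : a ≤ 1) (hb : 0 < b) {s : ℕ}
    (hs : 2 * a⁻¹ * Real.log b ≤ s) :
    (1 - a) ^ (s + 1) * b ≤ (1 - a / 2) ^ (s + 2) := by
  have hsq : (1 - a) ^ (s + 1) ≤ (1 - a / 2) ^ (s + 2) * (1 - a / 2) ^ s := by
    calc (1 - a) ^ (s + 1) ≤ ((1 - a / 2) ^ 2) ^ (s + 1) :=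
          pow_le_pow_left₀ (by linarith) (by nlinarith) _
      _ = (1 - a / 2) ^ (s + 2) * (1 - a / 2) ^ s := by
          rw [← pow_mul, ← pow_add]
          congr 1
          ring
  have hlog : Real.log b ≤ s * (a / 2) := by
    have h := mul_le_mul_of_nonneg_right hs (half_pos ha).le
    have h' : 2 * a⁻¹ * Real.log b * (a / 2) = Real.log b := by
      field_simp
    linarith
  have hdecay : (1 - a / 2) ^ s * b ≤ 1 := by
    calc (1 - a / 2) ^ s * b ≤ Real.exp (-(a / 2)) ^ s * Real.exp (s * (a / 2)) := by
          gcongr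
          · linarith
          · exact Real.one_sub_le_exp_neg _
          · exact (Real.log_le_iff_le_exp hb).1 hlog
      _ = 1 := by
          rw [← Real.exp_nat_mul, ← Real.exp_add]
          simp
  calc (1 - a) ^ (s + 1) * b ≤ (1 - a / 2) ^ (s + 2) * (1 - a / 2) ^ s * b :=
        mul_le_mul_of_nonneg_right hsq hb.le
    _ = (1 - a / 2) ^ (s + 2) * ((1 - a / 2) ^ s * b) := by ring
    _ ≤ (1 - a / 2) ^ (s + 2) :=
        mul_le_of_le_one_right (pow_nonneg (by linarith) _) hdecay

/-- Joos–Kühn mixing lemma. Let `(X_t)` be a Markov chain on `[n]`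
with transition matrix `P` having all entries nonzero and stationary distribution `σ`
with all entries nonzero. With `α = min_{i,j,k} P(i,j)/σ(k)` and
`β = max_{i,j,k} P(i,j)/σ(k)`, every `t ≥ 2 + 2α⁻¹ log β` and state `i` satisfy
`|ℙ[X_t = i] - σ i| ≤ (1 - α/2)^t σ i`.
The Markov property is expressed via the one-step joint law
`ℙ[X_{t+1} = j ∧ X_t = i] = P(i,j) · ℙ[X_t = i]`, which is exactly the statement
`ℙ[X_{t+1} = j ∣ X_t = i] = P(i,j)` for an arbitrary initial distribution. -/
theorem markov_chain_mixing
    {Ω : Type*} [MeasurableSpace Ω] (μ : Measure Ω) [IsProbabilityMeasure μ]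
    (n : ℕ) (hn : 0 < n)
    (X : ℕ → Ω → Fin n) (hX : ∀ t, Measurable (X t))
    (P : Matrix (Fin n) (Fin n) ℝ)
    (hPnonneg : ∀ i j, 0 ≤ P i j) (hProw : ∀ i, ∑ j, P i j = 1)
    (hPne : ∀ i j, P i j ≠ 0)
    (hMarkov : ∀ t : ℕ, ∀ i j : Fin n,
      μ {ω | X (t + 1) ω = j ∧ X t ω = i} = ENNReal.ofReal (P i j) * μ {ω | X t ω = i})
    (σ : Fin n → ℝ) (hσnonneg : ∀ i, 0 ≤ σ i) (hσsum : ∑ i, σ i = 1)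
    (hσne : ∀ i, σ i ≠ 0)
    (hstat : ∀ j, ∑ i, σ i * P i j = σ j)
    (α β : ℝ)
    (hα : IsLeast {x : ℝ | ∃ i j k : Fin n, x = P i j / σ k} α)
    (hβ : IsGreatest {x : ℝ | ∃ i j k : Fin n, x = P i j / σ k} β)
    (t : ℕ) (ht : 2 + 2 * α⁻¹ * Real.log β ≤ (t : ℝ))
    (i : Fin n) :
    |(μ {ω | X t ω = i}).toReal - σ i| ≤ (1 - α / 2) ^ t * σ i := by
  have hσpos (k) : 0 < σ k := (hσnonneg k).lt_of_ne' (hσne k)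
  have hminor (k j) : α * σ j ≤ P k j := (le_div_iff₀ (hσpos j)).1 (hα.2 ⟨k, j, j, rfl⟩)
  have hmajor (k j) : P k j ≤ β * σ j := (div_le_iff₀ (hσpos j)).1 (hβ.2 ⟨k, j, j, rfl⟩)
  have hαpos : 0 < α := by
    obtain ⟨a, b, c, h⟩ := hα.1
    exact h ▸ div_pos ((hPnonneg a b).lt_of_ne' (hPne a b)) (hσpos c)
  have hα1 : α ≤ 1 := by
    have h := Finset.sum_le_sum fun j (_ : j ∈ Finset.univ) => hminor i j
    rwa [← Finset.mul_sum, hσsum, hProw, mul_one] at h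
  have hβ1 : 1 ≤ β := by
    have h := Finset.sum_le_sum fun j (_ : j ∈ Finset.univ) => hmajor i j
    rwa [← Finset.mul_sum, hσsum, hProw, mul_one] at h
  have hmass (s) : ∑ k, μ.real {ω | X s ω = k} = 1 := sum_measureReal_fiber μ (hX s)
  have hstep (s j) := measureReal_succ_eq_sum μ (hX s) (hX (s + 1)) hPnonneg (hMarkov s) j
  have hdev (s : ℕ) (j) : |μ.real {ω | X (s + 1) ω = j} - σ j| ≤ (1 - α) ^ s * β * σ j := by
    induction s generalizing j with
    | zero =>
      have hle : μ.real {ω | X (0 + 1) ω = j} ≤ β * σ j := by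
        rw [hstep]
        calc ∑ k, μ.real {ω | X 0 ω = k} * P k j
            ≤ ∑ k, μ.real {ω | X 0 ω = k} * (β * σ j) :=
              Finset.sum_le_sum fun k _ =>
                mul_le_mul_of_nonneg_left (hmajor k j) measureReal_nonneg
          _ = β * σ j := by rw [← Finset.sum_mul, hmass, one_mul]
      have hnonneg : 0 ≤ μ.real {ω | X (0 + 1) ω = j} := measureReal_nonneg
      have hσβ : σ j ≤ β * σ j := le_mul_of_one_le_left (hσnonneg j) hβ1
      rw [pow_zero, one_mul, abs_le]
      constructor <;> linarith [hσnonneg j]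
    | succ s ih =>
      have h := abs_sum_mul_le_of_minorization hσsum hstat hminor
        (d := fun k => μ.real {ω | X (s + 1) ω = k} - σ k)
        (by rw [Finset.sum_sub_distrib, hmass, hσsum, sub_self]) ih j
      simp only [sub_mul, Finset.sum_sub_distrib, hstat, ← hstep] at h
      refine h.trans_eq ?_
      ring
  have ht2 : 2 ≤ t := by
    have h : 0 ≤ 2 * α⁻¹ * Real.log β :=
      mul_nonneg (by positivity) (Real.log_nonneg hβ1)
    exact_mod_cast (by linarith : (2 : ℝ) ≤ t)
  obtain ⟨s, rfl⟩ := Nat.exists_eq_add_of_le' ht2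
  push_cast at ht
  exact (hdev (s + 1) i).trans (mul_le_mul_of_nonneg_right
    (pow_mul_le_half_pow hαpos hα1 (zero_lt_one.trans_le hβ1) (by linarith)) (hσnonneg i))
end

section
/- For every δ ∈ (0,1] there exists τ₀ > 0 such that for all τ, ν with 0 < ν ≤ τ ≤ τ₀ there exists n₀ ∈ ℕ such that the following holds for every n ≥ n₀ and every integer k with ν^{−1} + 1 ≤ k ≤ 2ν^{−1}: if D is a δn-regular robust (ν,τ)-outexpander on vertex set [n] and P is the transition matrix of the simple random walk on D (i.e. P(i,j) = 1/(δn) if ij is an arc of D and P(i,j) = 0 otherwise), then the uniform distribution on [n] is the unique stationary distribution of P, and for all i, j ∈ [n] one has ν^{k−1}·δ^{−k}·n^{−1} ≤ P^k(i,j) ≤ δ^{−1}·n^{−1}. -/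
open Finset

namespace RPM

theorem natCard_setOf_eq_card_filter {V : Type*} [Fintype V] (p : V → Prop) [DecidablePred p] :
    Nat.card {u : V | p u} = (univ.filter p).card := by
  rw [Nat.card_eq_fintype_card, Fintype.card_ofFinset]
  simp

/-- Vertices with many inneighbours in `S` inherit a lower bound on `Q i` over `S`. -/
theorem le_mul_apply_of_le_on {V : Type*} [Fintype V] {D : V → V → Prop} {P Q : Matrix V V ℝ}
    {S : Set V} {i v : V} {a c m : ℝ} (ha : 0 ≤ a) (hc : 0 ≤ c)
    (hQ : ∀ u, 0 ≤ Q i u) (hP : ∀ u, 0 ≤ P u v) (hPD : ∀ u, D u v → P u v = a)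
    (hS : ∀ u ∈ S, c ≤ Q i u) (hm : m ≤ (Nat.card {u : V | u ∈ S ∧ D u v} : ℝ)) :
    m * (c * a) ≤ (Q * P) i v := by
  classical
  rw [natCard_setOf_eq_card_filter] at hm
  calc m * (c * a) ≤ ((univ.filter fun u => u ∈ S ∧ D u v).card : ℝ) * (c * a) := by gcongr
    _ = ∑ _u ∈ univ.filter (fun u => u ∈ S ∧ D u v), c * a := by simp
    _ ≤ ∑ u ∈ univ.filter (fun u => u ∈ S ∧ D u v), Q i u * P u v := by
        refine sum_le_sum fun u hu => ?_
        obtain ⟨huS, huD⟩ := (mem_filter.mp hu).2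
        rw [hPD u huD]
        exact mul_le_mul_of_nonneg_right (hS u huS) ha
    _ ≤ ∑ u, Q i u * P u v :=
        sum_le_sum_of_subset_of_nonneg (filter_subset _ _)
          fun u _ _ => mul_nonneg (hQ u) (hP u)
    _ = (Q * P) i v := (Matrix.mul_apply).symm

/-- At most `|V| - |S|` inneighbours of `v` lie outside `S`. -/
theorem inDeg_add_card_le {V : Type*} [Fintype V] (D : V → V → Prop) (S : Set V) (v : V) :
    inDeg D v + Nat.card S ≤ Nat.card {u : V | u ∈ S ∧ D u v} + Fintype.card V := by
  classical
  have hS : Nat.card S = (univ.filter (· ∈ S)).card := natCard_setOf_eq_card_filter (· ∈ S)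
  have h := card_union_add_card_inter (univ.filter fun u => D u v) (univ.filter (· ∈ S))
  have hle := card_le_univ ((univ.filter fun u => D u v) ∪ univ.filter (· ∈ S))
  have hinter : (univ.filter fun u => D u v) ∩ univ.filter (· ∈ S) =
      univ.filter fun u => u ∈ S ∧ D u v := by
    ext u; simp [and_comm]
  rw [hinter] at h
  rw [inDeg, natCard_setOf_eq_card_filter, natCard_setOf_eq_card_filter, hS]
  omega

/-- In a regular robust outexpander, the set of vertices satisfying the walk lower bound grows
by `νn` in each step until it has size at least `(1 - τ)n`. -/
theorem exists_large_set_pow_lower_bound {n : ℕ} {δ τ ν : ℝ} (hδ : 0 < δ)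
    (hν : 0 < ν) (hντ : ν ≤ τ) (hτδ : τ ≤ δ / 2) (hn : 0 < n) {D : Fin n → Fin n → Prop}
    (hreg : ∀ v : Fin n, (outDeg D v : ℝ) = δ * (n : ℝ) ∧ (inDeg D v : ℝ) = δ * (n : ℝ))
    (hexp : RobustOutexpander D ν τ) {P : Matrix (Fin n) (Fin n) ℝ}
    (hP : ∀ i j : Fin n, D i j → P i j = 1 / (δ * (n : ℝ))) (hP0 : ∀ i j, 0 ≤ P i j)
    (i : Fin n) (t : ℕ) :
    ∃ S : Set (Fin n), min (1 - τ) (δ + t * ν) * n ≤ (Nat.card S : ℝ) ∧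
      ∀ v ∈ S, ν ^ t * δ⁻¹ ^ (t + 1) * (n : ℝ)⁻¹ ≤ (P ^ (t + 1)) i v := by
  have hnR : (0 : ℝ) < n := by exact_mod_cast hn
  have ha : 0 ≤ 1 / (δ * (n : ℝ)) := by positivity
  have hpow : ∀ m : ℕ, ∀ i j, 0 ≤ (P ^ m) i j := by
    intro m
    induction m with
    | zero => intro i j; by_cases h : i = j <;> simp [h]
    | succ m ih =>
      intro i j
      rw [pow_succ, Matrix.mul_apply]
      exact sum_nonneg fun u _ => mul_nonneg (ih i u) (hP0 u j)
  induction t with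
  | zero =>
    refine ⟨{v | D i v}, ?_, fun v hv => ?_⟩
    · have h : (Nat.card {v | D i v} : ℝ) = δ * n := (hreg i).1
      rw [h]
      gcongr
      simp
    · have h := hP i v hv
      simp only [zero_add, pow_one, pow_zero, one_mul]
      rw [h, one_div, mul_inv]
  | succ t ih =>
    obtain ⟨S, hcard, hS⟩ := ih
    have step : ∀ v, ν * n ≤ (Nat.card {u : Fin n | u ∈ S ∧ D u v} : ℝ) →
        ν ^ (t + 1) * δ⁻¹ ^ (t + 1 + 1) * (n : ℝ)⁻¹ ≤ (P ^ (t + 1 + 1)) i v := by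
      intro v hv
      have h := le_mul_apply_of_le_on (Q := P ^ (t + 1)) ha
        (by positivity : 0 ≤ ν ^ t * δ⁻¹ ^ (t + 1) * (n : ℝ)⁻¹)
        (hpow _ i) (fun u => hP0 u v) (fun u => hP u v) hS hv
      rw [pow_succ P]
      refine le_of_eq_of_le ?_ h
      rw [pow_succ ν, pow_succ δ⁻¹ (t + 1)]
      field_simp
    rcases le_or_gt ((1 - τ) * n) (Nat.card S : ℝ) with hbig | hsmall
    · refine ⟨Set.univ, ?_, fun v _ => step v ?_⟩
      · have h : (Nat.card (Set.univ : Set (Fin n)) : ℝ) = n := by simp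
        rw [h]
        have : min (1 - τ) (δ + ((t + 1 : ℕ) : ℝ) * ν) ≤ 1 := (min_le_left _ _).trans (by linarith)
        nlinarith
      · have h : (inDeg D v : ℝ) + Nat.card S ≤ Nat.card {u | u ∈ S ∧ D u v} + n := by
          have := inDeg_add_card_le D S v
          rw [Fintype.card_fin] at this
          exact_mod_cast this
        rw [(hreg v).2] at h
        nlinarith
    · have hgrow : (δ + t * ν) * n ≤ (Nat.card S : ℝ) := by
        rcases min_choice (1 - τ) (δ + t * ν) with h | h <;> rw [h] at hcard
        · linarith
        · exact hcard
      have hlow : τ * n ≤ (Nat.card S : ℝ) := by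
        refine le_trans ?_ hgrow
        have : 0 ≤ (t : ℝ) * ν := by positivity
        gcongr
        linarith
      have hR := hexp S (by simpa using hlow) (by simpa using hsmall.le)
      rw [Fintype.card_fin] at hR
      refine ⟨RNplus D ν S, ?_, fun v hv => step v ?_⟩
      · refine le_trans ?_ hR
        calc min (1 - τ) (δ + ((t + 1 : ℕ) : ℝ) * ν) * n
            ≤ (δ + ((t + 1 : ℕ) : ℝ) * ν) * n := by gcongr; exact min_le_right _ _
          _ ≤ _ := by push_cast; linarith
      · simpa [RNplus] using hv

/-- A stationary vector of a positive matrix with unit column sums is constant. -/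
theorem eq_of_sum_mul_eq_of_pos {V : Type*} [Fintype V] {Q : Matrix V V ℝ} {σ : V → ℝ}
    (hQ : ∀ i j, 0 < Q i j) (hcol : ∀ j, ∑ i, Q i j = 1)
    (hσ : ∀ j, ∑ i, σ i * Q i j = σ j) (i j : V) : σ i = σ j := by
  have : Nonempty V := ⟨i⟩
  obtain ⟨m, hm⟩ := Finite.exists_min σ
  have hzero : ∑ i, (σ i - σ m) * Q i m = 0 := by
    simp only [sub_mul, sum_sub_distrib, ← mul_sum, hcol, hσ]
    ring
  have hall : ∀ i, σ i = σ m := by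
    intro i
    have h := (sum_eq_zero_iff_of_nonneg fun i _ =>
      mul_nonneg (sub_nonneg.mpr (hm i)) (hQ i m).le).mp hzero i (mem_univ i)
    have := (mul_eq_zero.mp h).resolve_right (hQ i m).ne'
    linarith
  rw [hall i, hall j]

/-- For a `δn`-regular robust `(ν,τ)`-outexpander `D` on `[n]` and the
transition matrix `P` of the simple random walk on `D`, the uniform distribution is the
unique stationary distribution, and `ν^{k-1} δ^{-k} n⁻¹ ≤ P^k(i,j) ≤ δ⁻¹ n⁻¹` for all
`ν⁻¹ + 1 ≤ k ≤ 2ν⁻¹`. -/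
theorem random_walk_power_bounds :
    ∀ δ : ℝ, 0 < δ → δ ≤ 1 →
    ∃ τ₀ : ℝ, 0 < τ₀ ∧
    ∀ τ ν : ℝ, 0 < ν → ν ≤ τ → τ ≤ τ₀ →
    ∃ n₀ : ℕ, ∀ n : ℕ, n₀ ≤ n →
    ∀ k : ℕ, ν⁻¹ + 1 ≤ (k : ℝ) → (k : ℝ) ≤ 2 * ν⁻¹ →
    ∀ D : Fin n → Fin n → Prop,
      (∀ v : Fin n, (outDeg D v : ℝ) = δ * (n : ℝ) ∧ (inDeg D v : ℝ) = δ * (n : ℝ)) →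
      RobustOutexpander D ν τ →
    ∀ P : Matrix (Fin n) (Fin n) ℝ,
      (∀ i j : Fin n, (D i j → P i j = 1 / (δ * (n : ℝ))) ∧ (¬ D i j → P i j = 0)) →
      ((∀ j : Fin n, ∑ i : Fin n, (1 / (n : ℝ)) * P i j = 1 / (n : ℝ)) ∧
        (∀ σ : Fin n → ℝ, (∀ i, 0 ≤ σ i) → (∑ i : Fin n, σ i) = 1 →
          (∀ j : Fin n, ∑ i : Fin n, σ i * P i j = σ j) → ∀ i : Fin n, σ i = 1 / (n : ℝ))) ∧
      ∀ i j : Fin n,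
        ν ^ (k - 1) * δ⁻¹ ^ k * (n : ℝ)⁻¹ ≤ (P ^ k) i j ∧
        (P ^ k) i j ≤ δ⁻¹ * (n : ℝ)⁻¹ := by
  intro δ hδ _
  refine ⟨δ / 2, by positivity, fun τ ν hν hντ hτ => ⟨1, ?_⟩⟩
  intro n hn k hk _ D hreg hexp P hPdef
  classical
  have hnR : (0 : ℝ) < n := by exact_mod_cast hn
  have hPite : ∀ i j, P i j = if D i j then 1 / (δ * (n : ℝ)) else 0 := by
    intro i j
    split_ifs with h
    · exact (hPdef i j).1 h
    · exact (hPdef i j).2 h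
  have hP0 : ∀ i j, 0 ≤ P i j := by
    intro i j
    rw [hPite]
    split_ifs <;> positivity
  have hPle : ∀ i j, P i j ≤ δ⁻¹ * (n : ℝ)⁻¹ := by
    intro i j
    rw [hPite]
    split_ifs
    · rw [one_div, mul_inv]
    · positivity
  have hrow : ∀ i, ∑ j, P i j = 1 := by
    intro i
    have h := (hreg i).1
    rw [outDeg, natCard_setOf_eq_card_filter] at h
    simp only [hPite, ← sum_filter, sum_const, nsmul_eq_mul, h]
    field_simp
  have hcol : ∀ j, ∑ i, P i j = 1 := by
    intro j
    have h := (hreg j).2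
    rw [inDeg, natCard_setOf_eq_card_filter] at h
    simp only [hPite, ← sum_filter, sum_const, nsmul_eq_mul, h]
    field_simp
  have hstoch : P ∈ doublyStochastic ℝ (Fin n) :=
    mem_doublyStochastic_iff_sum.mpr ⟨hP0, hrow, hcol⟩
  have hpow : ∀ m : ℕ, (∀ i j, 0 ≤ (P ^ m) i j) ∧ (∀ i, ∑ j, (P ^ m) i j = 1) ∧
      ∀ j, ∑ i, (P ^ m) i j = 1 :=
    fun m => mem_doublyStochastic_iff_sum.mp (pow_mem hstoch m)
  have hνinv : 0 < ν⁻¹ := inv_pos.mpr hν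
  obtain ⟨s, rfl⟩ : ∃ s, k = s + 2 := by
    have : 1 < k := by exact_mod_cast (by linarith : (1 : ℝ) < k)
    exact ⟨k - 2, by omega⟩
  have hlower : ∀ i j, ν ^ (s + 2 - 1) * δ⁻¹ ^ (s + 2) * (n : ℝ)⁻¹ ≤ (P ^ (s + 2)) i j := by
    intro i j
    obtain ⟨S, hcard, hS⟩ := exists_large_set_pow_lower_bound hδ hν hντ hτ hn hreg hexp
      (fun i j => (hPdef i j).1) hP0 i s
    have hsν : 1 - ν ≤ s * ν := by
      have h : ν⁻¹ - 1 ≤ (s : ℝ) := by push_cast at hk; linarith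
      have := mul_le_mul_of_nonneg_right h hν.le
      rwa [sub_mul, inv_mul_cancel₀ hν.ne', one_mul] at this
    rw [min_eq_left (by linarith)] at hcard
    have hin : (inDeg D j : ℝ) + Nat.card S ≤ Nat.card {u | u ∈ S ∧ D u j} + n := by
      have := inDeg_add_card_le D S j
      rw [Fintype.card_fin] at this
      exact_mod_cast this
    rw [(hreg j).2] at hin
    have hmany : ν * n ≤ (Nat.card {u | u ∈ S ∧ D u j} : ℝ) := by nlinarith
    have h := le_mul_apply_of_le_on (Q := P ^ (s + 1)) (a := 1 / (δ * (n : ℝ))) (by positivity)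
      (by positivity : 0 ≤ ν ^ s * δ⁻¹ ^ (s + 1) * (n : ℝ)⁻¹)
      ((hpow _).1 i) (fun u => hP0 u j) (fun u => (hPdef u j).1) hS hmany
    rw [pow_succ P]
    refine le_of_eq_of_le ?_ h
    rw [show s + 2 - 1 = s + 1 from rfl, pow_succ ν, pow_succ δ⁻¹ (s + 1)]
    field_simp
  refine ⟨⟨fun j => ?_, fun σ _ hσ1 hσP i => ?_⟩, fun i j => ⟨hlower i j, ?_⟩⟩
  · rw [← mul_sum, hcol, mul_one]
  · have hvec : ∀ m : ℕ, Matrix.vecMul σ (P ^ m) = σ := by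
      intro m
      induction m with
      | zero => simp
      | succ m ih => rw [pow_succ, ← Matrix.vecMul_vecMul, ih]; exact funext hσP
    have hconst := eq_of_sum_mul_eq_of_pos
      (fun i j => lt_of_lt_of_le (by positivity) (hlower i j)) (hpow (s + 2)).2.2
      (fun j => congrFun (hvec (s + 2)) j)
    have hsum : (n : ℝ) * σ i = 1 := by
      rw [← hσ1, sum_congr rfl fun j _ => hconst j i]
      simp
    field_simp
    linarith
  · rw [pow_succ P, Matrix.mul_apply]
    calc ∑ u, (P ^ (s + 1)) i u * P u j
        ≤ ∑ u, (P ^ (s + 1)) i u * (δ⁻¹ * (n : ℝ)⁻¹) :=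
          sum_le_sum fun u _ => mul_le_mul_of_nonneg_left (hPle u j) ((hpow _).1 i u)
      _ = δ⁻¹ * (n : ℝ)⁻¹ := by rw [← sum_mul, (hpow _).2.1, one_mul]

end RPM
end

section
/- For every δ ∈ (0,1] there exists τ₀ > 0 such that for all τ, ν with 0 < ν ≤ τ ≤ τ₀ there exists n₀ ∈ ℕ such that the following holds for every n ≥ n₀: if ℓ is an integer with (log n)² ≤ ℓ ≤ 2(log n)², D is a robust (ν,τ)-outexpander on n vertices in which every vertex has in-degree and out-degree exactly (1 − n^{−1/4})δn, and u, v are distinct vertices of D, then the number of directed walks from u to v of length ℓ in D is between (1 − n^{−1/5})·δ^ℓ·n^{ℓ−1} and (1 + n^{−1/5})·δ^ℓ·n^{ℓ−1}. -/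
open Finset

namespace RPM

/-- The real adjacency matrix of a digraph. -/
noncomputable def adjMat {V : Type*} (D : V → V → Prop) : Matrix V V ℝ :=
  open Classical in Matrix.of fun u v => if D u v then 1 else 0

lemma adjMat_nonneg {V : Type*} (D : V → V → Prop) (u v : V) : 0 ≤ adjMat D u v := by
  unfold adjMat
  simp only [Matrix.of_apply]
  split_ifs <;> norm_num

/-- Walks of length `ℓ + 1` decompose according to their second vertex. -/
lemma walkCount_succ {V : Type*} [Fintype V] (D : V → V → Prop) (u v : V) (ℓ : ℕ) :
    (walkCount D u v (ℓ + 1) : ℝ) = ∑ x, adjMat D u x * (walkCount D x v ℓ : ℝ) := by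
  classical
  let e : {w : Fin (ℓ + 1 + 1) → V // w 0 = u ∧ w (Fin.last (ℓ + 1)) = v ∧
      ∀ i : Fin (ℓ + 1), D (w i.castSucc) (w i.succ)} ≃
      Σ x : V, {w : Fin (ℓ + 1) → V // D u x ∧ w 0 = x ∧ w (Fin.last ℓ) = v ∧
        ∀ i : Fin ℓ, D (w i.castSucc) (w i.succ)} :=
    { toFun := fun w => ⟨w.1 1, fun i => w.1 i.succ, by
        obtain ⟨w, h0, h1, h2⟩ := w
        refine ⟨?_, rfl, h1, fun i => h2 i.succ⟩
        have := h2 0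
        simpa [h0] using this⟩
      invFun := fun p => ⟨Fin.cons u p.2.1, by
        obtain ⟨x, w, hx, h0, h1, h2⟩ := p
        refine ⟨rfl, h1, fun i => ?_⟩
        refine Fin.cases ?_ (fun j => ?_) i
        · simpa [h0] using hx
        · simpa [← Fin.succ_castSucc] using h2 j⟩
      left_inv := by
        rintro ⟨w, h0, h1, h2⟩
        apply Subtype.ext
        funext i
        refine Fin.cases ?_ (fun j => ?_) i
        · exact h0.symm
        · rfl
      right_inv := by
        rintro ⟨x, w, hx, rfl, h1, h2⟩
        rfl }
  rw [walkCount, Nat.card_congr e, Nat.card_sigma]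
  push_cast
  refine Finset.sum_congr rfl fun x _ => ?_
  by_cases hx : D u x
  · simp [hx, adjMat, walkCount]
  · simp [hx, adjMat]

lemma walkCount_eq_adjMat_pow {V : Type*} [Fintype V] [DecidableEq V] (D : V → V → Prop)
    (u v : V) (ℓ : ℕ) : (walkCount D u v ℓ : ℝ) = (adjMat D ^ ℓ) u v := by
  induction ℓ generalizing u with
  | zero =>
    rw [pow_zero, Matrix.one_apply]
    unfold walkCount
    split_ifs with h
    · subst h
      rw [Nat.cast_eq_one, Nat.card_eq_one_iff_unique]
      refine ⟨⟨?_⟩, ⟨⟨fun _ => u, rfl, rfl, fun i => i.elim0⟩⟩⟩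
      rintro ⟨w, hw, -⟩ ⟨w', hw', -⟩
      apply Subtype.ext
      funext i
      rw [Fin.fin_one_eq_zero i]
      exact hw.trans hw'.symm
    · rw [Nat.cast_eq_zero, Nat.card_eq_zero]
      left
      exact ⟨fun ⟨w, hw, hw', _⟩ => h (hw.symm.trans hw')⟩
  | succ ℓ ih =>
    rw [walkCount_succ, pow_succ', Matrix.mul_apply]
    exact Finset.sum_congr rfl fun x _ => by rw [ih]

lemma sum_adjMat_row {V : Type*} [Fintype V] (D : V → V → Prop) (u : V) :
    ∑ v, adjMat D u v = outDeg D u := by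
  classical
  simp [adjMat, outDeg, Nat.card_eq_fintype_card, Fintype.card_subtype]

lemma sum_adjMat_col {V : Type*} [Fintype V] (D : V → V → Prop) (v : V) :
    ∑ u, adjMat D u v = inDeg D v := by
  classical
  simp [adjMat, inDeg, Nat.card_eq_fintype_card, Fintype.card_subtype]

lemma adjMat_pow_nonneg {V : Type*} [Fintype V] [DecidableEq V] (D : V → V → Prop) (k : ℕ)
    (u v : V) : 0 ≤ (adjMat D ^ k) u v := by
  rw [← walkCount_eq_adjMat_pow]
  positivity

/-- If all entries of the `k`-th power in row `u` are at least `a` on `S`, then all entries of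
the next power are at least `a * (ν * n)` on the robust outneighbourhood of `S`. -/
lemma le_adjMat_pow_succ_of_mem_RNplus {V : Type*} [Fintype V] [DecidableEq V]
    {D : V → V → Prop} {ν a : ℝ} (ha : 0 ≤ a) {S : Set V} {u : V} {k : ℕ}
    (hS : ∀ x ∈ S, a ≤ (adjMat D ^ k) u x) {v : V} (hv : v ∈ RNplus D ν S) :
    a * (ν * Fintype.card V) ≤ (adjMat D ^ (k + 1)) u v := by
  classical
  have hv' : ν * (Fintype.card V : ℝ) ≤ (Nat.card {x : V | x ∈ S ∧ D x v} : ℝ) := hv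
  rw [pow_succ, Matrix.mul_apply]
  calc a * (ν * Fintype.card V) ≤ a * (Nat.card {x : V | x ∈ S ∧ D x v} : ℝ) := by gcongr
    _ = ∑ x, if x ∈ S ∧ D x v then a else 0 := by
        simp [Nat.card_eq_fintype_card, Fintype.card_subtype, ← Finset.sum_filter, mul_comm]
    _ ≤ _ := by
        refine Finset.sum_le_sum fun x _ => ?_
        split_ifs with h
        · simpa [adjMat, h.2] using hS x h.1
        · exact mul_nonneg (adjMat_pow_nonneg D k u x) (adjMat_nonneg D x v)

/-- Robust outneighbourhoods of very large sets contain every vertex of large in-degree. -/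
lemma RNplus_eq_univ {V : Type*} [Fintype V] {D : V → V → Prop} {ν τ : ℝ} (hντ : ν ≤ τ)
    (hin : ∀ v, 2 * τ * Fintype.card V ≤ (inDeg D v : ℝ)) {S : Set V}
    (hS : (1 - τ) * (Fintype.card V : ℝ) ≤ (Nat.card S : ℝ)) : RNplus D ν S = Set.univ := by
  classical
  refine Set.eq_univ_of_forall fun v => ?_
  change ν * (Fintype.card V : ℝ) ≤ (Nat.card {x : V | x ∈ S ∧ D x v} : ℝ)
  have h1 : Nat.card S + inDeg D v ≤ Nat.card {x : V | x ∈ S ∧ D x v} + Fintype.card V := by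
    have := Set.ncard_union_add_ncard_inter S {x | D x v}
    have h2 : (S ∪ {x | D x v}).ncard ≤ Fintype.card V := by
      rw [← Nat.card_eq_fintype_card]
      exact Set.ncard_le_card _
    have h3 : S ∩ {x | D x v} = {x : V | x ∈ S ∧ D x v} := rfl
    rw [h3] at this
    simp only [inDeg, Nat.card_coe_set_eq]
    omega
  have h1' : (Nat.card S : ℝ) + inDeg D v ≤
      Nat.card {x : V | x ∈ S ∧ D x v} + Fintype.card V := by exact_mod_cast h1
  have h4 := hin v
  have h5 : ν * (Fintype.card V : ℝ) ≤ τ * Fintype.card V := by gcongr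
  linarith

/-- The sets reached robustly from a fixed vertex grow by `ν * n` in each step. -/
lemma exists_large_robust_reach {V : Type*} [Fintype V] [DecidableEq V] {D : V → V → Prop}
    {ν τ : ℝ} (hν : 0 < ν) (hντ : ν ≤ τ) (hD : RobustOutexpander D ν τ)
    (hin : ∀ v, 2 * τ * Fintype.card V ≤ (inDeg D v : ℝ))
    (hout : ∀ v, 2 * τ * Fintype.card V ≤ (outDeg D v : ℝ)) (u : V) (i : ℕ) :
    ∃ S : Set V, τ * Fintype.card V ≤ (Nat.card S : ℝ) ∧
      min (Fintype.card V : ℝ) (i * (ν * Fintype.card V)) ≤ (Nat.card S : ℝ) ∧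
      ∀ x ∈ S, (ν * Fintype.card V) ^ i ≤ (adjMat D ^ (i + 1)) u x := by
  have hτ : 0 < τ := hν.trans_le hντ
  induction i with
  | zero =>
    refine ⟨{x | D u x}, ?_, ?_, fun x hx => ?_⟩
    · have : (0 : ℝ) ≤ τ * Fintype.card V := by positivity
      have h := hout u
      unfold outDeg at h
      linarith
    · simp
    · have hx' : D u x := hx
      simp [adjMat, hx']
  | succ i ih =>
    obtain ⟨S, h1, h2, h3⟩ := ih
    have hpow : ∀ x ∈ RNplus D ν S,
        (ν * (Fintype.card V : ℝ)) ^ (i + 1) ≤ (adjMat D ^ (i + 1 + 1)) u x := fun x hx => by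
      rw [pow_succ]
      exact le_adjMat_pow_succ_of_mem_RNplus (by positivity) h3 hx
    refine ⟨RNplus D ν S, ?_, ?_, hpow⟩ <;>
      rcases le_total ((Nat.card S : ℝ)) ((1 - τ) * (Fintype.card V : ℝ)) with h | h
    · have := hD S h1 h
      have : 0 ≤ ν * (Fintype.card V : ℝ) := by positivity
      linarith
    · rw [RNplus_eq_univ hντ hin h, Nat.card_univ, Nat.card_eq_fintype_card]
      have h5 := hin u
      have h6 : inDeg D u ≤ Fintype.card V := by
        rw [inDeg, ← Nat.card_eq_fintype_card, Nat.card_coe_set_eq]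
        exact Set.ncard_le_card _
      have h6' : (inDeg D u : ℝ) ≤ Fintype.card V := by exact_mod_cast h6
      have : 0 ≤ τ * (Fintype.card V : ℝ) := by positivity
      linarith
    · have h4 := hD S h1 h
      push_cast
      have : 0 ≤ ν * (Fintype.card V : ℝ) := by positivity
      rcases min_le_iff.1 h2 with h5 | h5
      · exact (min_le_left _ _).trans (by linarith)
      · exact (min_le_right _ _).trans (by linarith)
    · rw [RNplus_eq_univ hντ hin h, Nat.card_univ, Nat.card_eq_fintype_card]
      exact min_le_left _ _

lemma le_adjMat_pow_of_robustOutexpander {V : Type*} [Fintype V] [DecidableEq V]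
    {D : V → V → Prop} {ν τ : ℝ} (hν : 0 < ν) (hντ : ν ≤ τ) (hD : RobustOutexpander D ν τ)
    (hin : ∀ v, 2 * τ * Fintype.card V ≤ (inDeg D v : ℝ))
    (hout : ∀ v, 2 * τ * Fintype.card V ≤ (outDeg D v : ℝ)) {i : ℕ} (hi : 1 ≤ i * ν)
    (u v : V) : (ν * Fintype.card V) ^ i ≤ (adjMat D ^ (i + 1)) u v := by
  obtain ⟨S, -, h2, h3⟩ := exists_large_robust_reach hν hντ hD hin hout u i
  refine h3 v ?_
  have h4 : (Fintype.card V : ℝ) ≤ Nat.card S := by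
    refine le_trans (le_min le_rfl ?_) h2
    have : (0 : ℝ) ≤ Fintype.card V := by positivity
    nlinarith
  have h5 : Nat.card V ≤ S.ncard := by
    rw [Nat.card_eq_fintype_card, ← Nat.card_coe_set_eq]
    exact_mod_cast h4
  have : S = Set.univ := by
    refine Set.eq_of_subset_of_ncard_le (Set.subset_univ S) ?_
    rwa [Set.ncard_univ]
  simp [this]

/-- A doubly stochastic matrix with a power all of whose entries are at least `c / n` mixes
exponentially fast. -/
lemma abs_pow_sub_inv_card_le {V : Type*} [Fintype V] [DecidableEq V] {P : Matrix V V ℝ}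
    (hP : P ∈ doublyStochastic ℝ V) {c : ℝ} {t : ℕ}
    (hc : ∀ u v, c * (Fintype.card V : ℝ)⁻¹ ≤ (P ^ t) u v) (r m : ℕ) (u v : V) :
    |(P ^ (t * m + r)) u v - (Fintype.card V : ℝ)⁻¹| ≤ (1 - c) ^ m := by
  have : Nonempty V := ⟨u⟩
  have hn : (1 : ℝ) ≤ Fintype.card V := by exact_mod_cast Fintype.card_pos (α := V)
  have hsum : ∑ _x : V, (Fintype.card V : ℝ)⁻¹ = 1 := by simp
  induction m generalizing u with
  | zero =>
    have h1 := nonneg_of_mem_doublyStochastic (pow_mem hP r) (i := u) (j := v)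
    have h2 := le_one_of_mem_doublyStochastic (pow_mem hP r) (i := u) (j := v)
    have h3 : (Fintype.card V : ℝ)⁻¹ ≤ 1 := inv_le_one_of_one_le₀ hn
    have h4 : 0 ≤ (Fintype.card V : ℝ)⁻¹ := by positivity
    simp only [mul_zero, zero_add, pow_zero]
    rw [abs_le]
    constructor <;> linarith
  | succ m ih =>
    have hrow := sum_row_of_mem_doublyStochastic (pow_mem hP t) u
    have hcol := sum_col_of_mem_doublyStochastic (pow_mem hP (t * m + r)) v
    have key : (P ^ (t * (m + 1) + r)) u v - (Fintype.card V : ℝ)⁻¹ =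
        ∑ x, ((P ^ t) u x - c * (Fintype.card V : ℝ)⁻¹) *
          ((P ^ (t * m + r)) x v - (Fintype.card V : ℝ)⁻¹) := by
      rw [show t * (m + 1) + r = t + (t * m + r) by ring, pow_add, Matrix.mul_apply]
      simp only [sub_mul, mul_sub, Finset.sum_sub_distrib, ← Finset.mul_sum, ← Finset.sum_mul,
        hrow, hcol]
      simp
    rw [key]
    calc _ ≤ ∑ x, |((P ^ t) u x - c * (Fintype.card V : ℝ)⁻¹) *
          ((P ^ (t * m + r)) x v - (Fintype.card V : ℝ)⁻¹)| := Finset.abs_sum_le_sum_abs _ _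
      _ ≤ ∑ x, ((P ^ t) u x - c * (Fintype.card V : ℝ)⁻¹) * (1 - c) ^ m := by
        refine Finset.sum_le_sum fun x _ => ?_
        have h0 := sub_nonneg.2 (hc u x)
        rw [abs_mul, abs_of_nonneg h0]
        exact mul_le_mul_of_nonneg_left (ih x) h0
      _ = (1 - c) ^ (m + 1) := by
        rw [← Finset.sum_mul, Finset.sum_sub_distrib, hrow, ← Finset.mul_sum, hsum]
        ring

/-- Walk counts in regular robust outexpanders, with an explicit error term. -/
lemma abs_walkCount_sub_le {V : Type*} [Fintype V] {D : V → V → Prop} {ν τ d : ℝ}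
    (hν : 0 < ν) (hντ : ν ≤ τ) (hD : RobustOutexpander D ν τ) (hd : 2 * τ * Fintype.card V ≤ d)
    (hdeg : ∀ v, (outDeg D v : ℝ) = d ∧ (inDeg D v : ℝ) = d) {i : ℕ} (hi : 1 ≤ i * ν)
    (ℓ : ℕ) (u v : V) :
    |(walkCount D u v ℓ : ℝ) - d ^ ℓ * (Fintype.card V : ℝ)⁻¹| ≤
      d ^ ℓ * (1 - ν ^ i) ^ (ℓ / (i + 1)) := by
  classical
  have : Nonempty V := ⟨u⟩
  have hn : (0 : ℝ) < Fintype.card V := by exact_mod_cast Fintype.card_pos (α := V)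
  have hτ : 0 < τ := hν.trans_le hντ
  have hd0 : 0 < d := lt_of_lt_of_le (by positivity) hd
  have hdn : d ≤ Fintype.card V := by
    rw [← (hdeg u).1]
    have h6 : outDeg D u ≤ Fintype.card V := by
      rw [outDeg, ← Nat.card_eq_fintype_card, Nat.card_coe_set_eq]
      exact Set.ncard_le_card _
    exact_mod_cast h6
  set P : Matrix V V ℝ := d⁻¹ • adjMat D with hPdef
  have hPpow : ∀ k x y, (P ^ k) x y = (d ^ k)⁻¹ * (adjMat D ^ k) x y := fun k x y => by
    rw [hPdef, smul_pow, Matrix.smul_apply, smul_eq_mul, inv_pow]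
  have hP : P ∈ doublyStochastic ℝ V := by
    rw [mem_doublyStochastic_iff_sum]
    refine ⟨fun x y => ?_, fun x => ?_, fun y => ?_⟩
    · exact mul_nonneg (inv_nonneg.2 hd0.le) (adjMat_nonneg D x y)
    · simp only [hPdef, Matrix.smul_apply, smul_eq_mul, ← Finset.mul_sum, sum_adjMat_row,
        (hdeg x).1]
      exact inv_mul_cancel₀ hd0.ne'
    · simp only [hPdef, Matrix.smul_apply, smul_eq_mul, ← Finset.mul_sum, sum_adjMat_col,
        (hdeg y).2]
      exact inv_mul_cancel₀ hd0.ne'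
  have hmin : ∀ x y, ν ^ i * (Fintype.card V : ℝ)⁻¹ ≤ (P ^ (i + 1)) x y := fun x y => by
    have h1 := le_adjMat_pow_of_robustOutexpander hν hντ hD
      (fun v => by rw [(hdeg v).2]; exact hd) (fun v => by rw [(hdeg v).1]; exact hd) hi x y
    rw [hPpow]
    calc ν ^ i * (Fintype.card V : ℝ)⁻¹
        = ((Fintype.card V : ℝ) ^ (i + 1))⁻¹ * (ν * Fintype.card V) ^ i := by
          field_simp
          ring
      _ ≤ (d ^ (i + 1))⁻¹ * (adjMat D ^ (i + 1)) x y := by gcongr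
  have h := abs_pow_sub_inv_card_le hP hmin (ℓ % (i + 1)) (ℓ / (i + 1)) u v
  rw [Nat.div_add_mod, hPpow] at h
  rw [walkCount_eq_adjMat_pow]
  have hdl : 0 < d ^ ℓ := by positivity
  have h' : (adjMat D ^ ℓ) u v - d ^ ℓ * (Fintype.card V : ℝ)⁻¹ =
      d ^ ℓ * ((d ^ ℓ)⁻¹ * (adjMat D ^ ℓ) u v - (Fintype.card V : ℝ)⁻¹) := by
    field_simp
  rw [h', abs_mul, abs_of_pos hdl]
  gcongr

/-- Superpolynomial decay of the mixing error for lengths at least `(log n) ^ 2`. -/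
lemma eventually_mixing_error_le {c : ℝ} (hc : 0 < c) (hc1 : c ≤ 1) (t : ℕ) (ht : 0 < t) :
    ∀ᶠ n : ℕ in Filter.atTop, ∀ ℓ : ℕ, (Real.log n) ^ 2 ≤ (ℓ : ℝ) →
      (n : ℝ) * (1 - c) ^ (ℓ / t) ≤ (n : ℝ) ^ (-(1 / 5) : ℝ) / 2 := by
  have hlog : Filter.Tendsto (fun n : ℕ => Real.log n) Filter.atTop Filter.atTop :=
    Real.tendsto_log_atTop.comp tendsto_natCast_atTop_atTop
  filter_upwards [hlog.eventually_ge_atTop (4 * t / c), hlog.eventually_ge_atTop 1,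
    Filter.eventually_gt_atTop 0] with n h1 h2 h3 ℓ hℓ
  set L := Real.log n with hL
  have htR : (0 : ℝ) < t := by exact_mod_cast ht
  have hn : (0 : ℝ) < n := by exact_mod_cast h3
  have hm : (ℓ : ℝ) / t - 1 ≤ ((ℓ / t : ℕ) : ℝ) := by
    have h4 : ℓ < t * (ℓ / t + 1) := Nat.lt_mul_div_succ ℓ ht
    have h5 : (ℓ : ℝ) < t * (((ℓ / t : ℕ) : ℝ) + 1) := by exact_mod_cast h4
    rw [sub_le_iff_le_add, div_le_iff₀ htR]
    linarith
  have hexp : (1 - c) ^ (ℓ / t) ≤ Real.exp (-c * ((ℓ / t : ℕ) : ℝ)) := by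
    rw [mul_comm, Real.exp_nat_mul]
    have := Real.add_one_le_exp (-c)
    exact pow_le_pow_left₀ (by linarith) (by linarith) _
  have hbig : 4 * L ≤ c * (ℓ / t) := by
    rw [div_le_iff₀ hc] at h1
    have : 4 * L * t ≤ c * ℓ := by nlinarith
    rw [← mul_div_assoc, le_div_iff₀ htR]
    exact this
  have hexp2 : Real.exp (-c * ((ℓ / t : ℕ) : ℝ)) ≤ Real.exp (-3 * L) := by
    apply Real.exp_le_exp.2
    nlinarith
  have hnL : (n : ℝ) = Real.exp L := (Real.exp_log hn).symm
  have hhalf : Real.exp (-1) ≤ 1 / 2 := by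
    have := Real.add_one_le_exp 1
    rw [Real.exp_neg, inv_eq_one_div]
    apply one_div_le_one_div_of_le <;> linarith
  calc (n : ℝ) * (1 - c) ^ (ℓ / t) ≤ n * Real.exp (-3 * L) := by
        gcongr
        exact hexp.trans hexp2
    _ = Real.exp (-2 * L) := by
        rw [hnL, ← Real.exp_add]
        congr 1
        ring
    _ ≤ Real.exp (-(1 / 5) * L) * Real.exp (-1) := by
        rw [← Real.exp_add]
        apply Real.exp_le_exp.2
        linarith
    _ ≤ Real.exp (-(1 / 5) * L) * (1 / 2) := by gcongr
    _ = (n : ℝ) ^ (-(1 / 5) : ℝ) / 2 := by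
        rw [Real.rpow_def_of_pos hn, ← hL, mul_comm L]
        ring

lemma eventually_log_sq_mul_rpow_le :
    ∀ᶠ n : ℕ in Filter.atTop,
      2 * (Real.log n) ^ 2 * (n : ℝ) ^ (-(1 / 4) : ℝ) ≤ (n : ℝ) ^ (-(1 / 5) : ℝ) / 2 := by
  have h := (isLittleO_log_rpow_rpow_atTop (2 : ℝ) (show (0 : ℝ) < 1 / 20 by norm_num)).bound
    (show (0 : ℝ) < 1 / 4 by norm_num)
  filter_upwards [tendsto_natCast_atTop_atTop.eventually h, Filter.eventually_gt_atTop 0]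
    with n h1 h2
  have hn : (0 : ℝ) < n := by exact_mod_cast h2
  rw [Real.norm_eq_abs, Real.norm_eq_abs, abs_of_pos (Real.rpow_pos_of_pos hn _),
    Real.rpow_two, abs_of_nonneg (sq_nonneg _)] at h1
  have h3 : (n : ℝ) ^ (-(1 / 5) : ℝ) = (n : ℝ) ^ (1 / 20 : ℝ) * (n : ℝ) ^ (-(1 / 4) : ℝ) := by
    rw [← Real.rpow_add hn]
    norm_num
  rw [h3]
  have := mul_le_mul_of_nonneg_right h1 (Real.rpow_pos_of_pos hn (-(1 / 4))).le
  linarith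

/-- Counting walks of length `ℓ ≈ log² n` between two distinct vertices
in an exactly `(1 - n^{-1/4})δn`-regular robust outexpander. -/
theorem count_walks_in_regular_outexpander :
    ∀ δ : ℝ, 0 < δ → δ ≤ 1 →
    ∃ τ₀ : ℝ, 0 < τ₀ ∧
    ∀ τ ν : ℝ, 0 < ν → ν ≤ τ → τ ≤ τ₀ →
    ∃ n₀ : ℕ, ∀ n : ℕ, n₀ ≤ n →
    ∀ ℓ : ℕ, (Real.log n) ^ 2 ≤ (ℓ : ℝ) → (ℓ : ℝ) ≤ 2 * (Real.log n) ^ 2 →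
    ∀ (V : Type) [Fintype V], Fintype.card V = n →
    ∀ D : V → V → Prop, RobustOutexpander D ν τ →
      (∀ v : V, (outDeg D v : ℝ) = (1 - (n : ℝ) ^ (-(1 / 4) : ℝ)) * δ * (n : ℝ) ∧
        (inDeg D v : ℝ) = (1 - (n : ℝ) ^ (-(1 / 4) : ℝ)) * δ * (n : ℝ)) →
    ∀ u v : V, u ≠ v →
      (1 - (n : ℝ) ^ (-(1 / 5) : ℝ)) * δ ^ ℓ * (n : ℝ) ^ (ℓ - 1) ≤ (walkCount D u v ℓ : ℝ) ∧
      (walkCount D u v ℓ : ℝ) ≤ (1 + (n : ℝ) ^ (-(1 / 5) : ℝ)) * δ ^ ℓ * (n : ℝ) ^ (ℓ - 1) := by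
  intro δ hδ hδ1
  refine ⟨δ / 4, by positivity, fun τ ν hν hντ hτ => ?_⟩
  obtain ⟨i, hi⟩ := exists_nat_ge (1 / ν)
  have hi' : 1 ≤ i * ν := by rwa [div_le_iff₀ hν] at hi
  have hc : 0 < ν ^ i := by positivity
  have hc1 : ν ^ i ≤ 1 := pow_le_one₀ hν.le (by linarith)
  have hlog : Filter.Tendsto (fun n : ℕ => Real.log n) Filter.atTop Filter.atTop :=
    Real.tendsto_log_atTop.comp tendsto_natCast_atTop_atTop
  obtain ⟨n₀, hn₀⟩ := Filter.eventually_atTop.1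
    ((eventually_mixing_error_le hc hc1 (i + 1) i.succ_pos).and
      (eventually_log_sq_mul_rpow_le.and
        ((hlog.eventually_ge_atTop 1).and (Filter.eventually_gt_atTop 0))))
  refine ⟨n₀, fun n hn ℓ hℓ hℓ' V _ hV D hD hdeg u v _ => ?_⟩
  obtain ⟨hmix, hsq, hL, hn1⟩ := hn₀ n hn
  have hmix := hmix ℓ hℓ
  have hnpos : (0 : ℝ) < n := by exact_mod_cast hn1
  have hn1R : (1 : ℝ) ≤ n := by exact_mod_cast hn1
  set x := (n : ℝ) ^ (-(1 / 4) : ℝ) with hx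
  set y := (n : ℝ) ^ (-(1 / 5) : ℝ) with hy
  have hx0 : 0 < x := Real.rpow_pos_of_pos hnpos _
  have hy1 : y ≤ 1 := Real.rpow_le_one_of_one_le_of_nonpos hn1R (by norm_num)
  have hxhalf : x ≤ 1 / 2 := by nlinarith
  have hℓ0 : ℓ ≠ 0 := by
    rintro rfl
    rw [Nat.cast_zero] at hℓ
    nlinarith
  have hd : 2 * τ * (Fintype.card V : ℝ) ≤ (1 - x) * δ * n := by
    rw [hV]
    exact mul_le_mul_of_nonneg_right (by nlinarith) hnpos.le
  have hmain := abs_walkCount_sub_le hν hντ hD hd hdeg hi' ℓ u v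
  rw [hV] at hmain
  set e := (1 - ν ^ i) ^ (ℓ / (i + 1)) with he
  have hnl : (n : ℝ) ^ ℓ = n ^ (ℓ - 1) * n := by
    rw [← pow_succ, Nat.sub_add_cancel (Nat.one_le_iff_ne_zero.2 hℓ0)]
  have hbern : 1 - ℓ * x ≤ (1 - x) ^ ℓ := by
    have := one_add_mul_le_pow (show (-2 : ℝ) ≤ -x by linarith) ℓ
    rw [← sub_eq_add_neg] at this
    linarith
  have hle1 : (1 - x) ^ ℓ ≤ 1 := pow_le_one₀ (by linarith) (by linarith)
  have hle0 : 0 ≤ (1 - x) ^ ℓ := pow_nonneg (by linarith) _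
  have hℓx : ℓ * x ≤ y / 2 := (mul_le_mul_of_nonneg_right hℓ' hx0.le).trans hsq
  have hB : 0 < δ ^ ℓ * (n : ℝ) ^ (ℓ - 1) := by positivity
  have he0 : 0 ≤ (n : ℝ) * e := by
    have : 0 ≤ 1 - ν ^ i := by linarith
    positivity
  have h1 : ((1 - x) * δ * n) ^ ℓ * (n : ℝ)⁻¹ = (1 - x) ^ ℓ * (δ ^ ℓ * n ^ (ℓ - 1)) := by
    rw [mul_pow, mul_pow, hnl]
    field_simp
  have h2 : ((1 - x) * δ * n) ^ ℓ * e = (1 - x) ^ ℓ * (n * e) * (δ ^ ℓ * n ^ (ℓ - 1)) := by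
    rw [mul_pow, mul_pow, hnl]
    ring
  rw [h1, h2, abs_le] at hmain
  have hpe : (1 - x) ^ ℓ * (n * e) ≤ y / 2 :=
    (mul_le_of_le_one_left he0 hle1).trans hmix
  constructor
  · have h3 : (1 - y) * (δ ^ ℓ * (n : ℝ) ^ (ℓ - 1)) ≤
        ((1 - x) ^ ℓ - (1 - x) ^ ℓ * (n * e)) * (δ ^ ℓ * (n : ℝ) ^ (ℓ - 1)) :=
      mul_le_mul_of_nonneg_right (by linarith) hB.le
    linarith [hmain.1]
  · have hy0 : 0 < y := Real.rpow_pos_of_pos hnpos _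
    have h3 : ((1 - x) ^ ℓ + (1 - x) ^ ℓ * (n * e)) * (δ ^ ℓ * (n : ℝ) ^ (ℓ - 1)) ≤
        (1 + y) * (δ ^ ℓ * (n : ℝ) ^ (ℓ - 1)) :=
      mul_le_mul_of_nonneg_right (by linarith) hB.le
    linarith [hmain.2]

end RPM
end

section
/- Let G be a graph on n vertices that is a robust (ν,τ)-expander in which every vertex has degree exactly δn, and let M be a perfect matching of G. Define a digraph D on V(G) by putting an arc from x to y whenever xz ∈ E(G), where z is the M-partner of y (i.e. zy ∈ M). Then every vertex of D has out-degree and in-degree exactly δn, and D is a robust (ν,τ)-outexpander. -/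
open Finset

namespace RPM

/-- A perfect matching induces the permutation of the vertices that sends each vertex to
its partner. -/
theorem IsPM.exists_partner {V : Type*} {G : SimpleGraph V} {M : Finset (Sym2 V)}
    (hM : IsPM G M) : ∃ p : Equiv.Perm V, ∀ z y : V, s(z, y) ∈ M ↔ z = p y := by
  have hex : ∀ y : V, ∃ z : V, s(z, y) ∈ M := by
    intro y
    obtain ⟨e, ⟨he, hy⟩, -⟩ := hM.2 y
    obtain ⟨z, rfl⟩ := Sym2.mem_iff_exists.1 hy
    exact ⟨z, by rwa [Sym2.eq_swap]⟩
  choose p hp using hex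
  have huniq : ∀ z y : V, s(z, y) ∈ M → z = p y := by
    intro z y h
    have h' := (hM.2 y).unique ⟨h, Sym2.mem_mk_right z y⟩ ⟨hp y, Sym2.mem_mk_right (p y) y⟩
    exact Sym2.congr_left.1 h'
  have hinv : Function.Involutive p := by
    intro y
    exact (huniq y (p y) (by rw [Sym2.eq_swap]; exact hp y)).symm
  refine ⟨hinv.toPerm, fun z y => ⟨huniq z y, ?_⟩⟩
  rintro rfl
  exact hp y

/-- Precomposing a predicate with a permutation does not change how many elements satisfy it. -/
theorem card_setOf_comp_perm {V : Type*} (p : Equiv.Perm V) (P : V → Prop) :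
    Nat.card {u : V | P (p u)} = Nat.card {u : V | P u} :=
  Nat.card_congr (p.subtypeEquiv fun _ => Iff.rfl)

/-- Given a `δn`-regular robust `(ν,τ)`-expander `G` and a perfect
matching `M` of `G`, the digraph `D` with an arc `x → y` whenever `xz ∈ E(G)` for the
`M`-partner `z` of `y` is `δn`-regular and a robust `(ν,τ)`-outexpander. -/
theorem auxiliary_digraph_is_robust_outexpander :
    ∀ (V : Type) [Fintype V],
    ∀ (G : SimpleGraph V) (ν τ δ : ℝ),
    RobustExpander G ν τ →
    (∀ v : V, (Nat.card {u : V | G.Adj v u} : ℝ) = δ * (Fintype.card V : ℝ)) →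
    ∀ M : Finset (Sym2 V), IsPM G M →
    ∀ D : V → V → Prop,
      (∀ x y : V, D x y ↔ ∃ z : V, s(z, y) ∈ M ∧ G.Adj x z) →
      (∀ v : V, (outDeg D v : ℝ) = δ * (Fintype.card V : ℝ) ∧
        (inDeg D v : ℝ) = δ * (Fintype.card V : ℝ)) ∧
      RobustOutexpander D ν τ := by
  intro V _ G ν τ δ hG hdeg M hM D hD
  obtain ⟨p, hp⟩ := hM.exists_partner
  have hDp : ∀ x y : V, D x y ↔ G.Adj x (p y) := by simp [hD, hp]
  refine ⟨fun v => ⟨?_, ?_⟩, fun S hS₁ hS₂ => ?_⟩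
  · simp only [outDeg, hDp]
    rw [card_setOf_comp_perm p (G.Adj v), hdeg]
  · simp only [inDeg, hDp, G.adj_comm _ (p v)]
    exact hdeg (p v)
  · have hRN : RNplus D ν S = {v : V | p v ∈ RN G ν S} := by
      ext v
      simp only [RNplus, RN, hDp, G.adj_comm _ (p v), Set.mem_ofPred_eq]
    rw [hRN, card_setOf_comp_perm p (· ∈ RN G ν S)]
    exact hG S hS₁ hS₂

end RPM
end
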